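/- Every irreducible plane algebraic curve over an algebraically closed field is birationally equivalent to a plane curve whose only singular points are ordinary double points (nodes). -/

import Mathlib

open MvPolynomial

variable {k : Type} [Field k]

/-- Iterated partial derivatives along a list of variable indices. -/
noncomputable def pderivList {n : ℕ} (s : List (Fin n)) (F : MvPolynomial (Fin n) k) :
    MvPolynomial (Fin n) k :=
  s.foldr (fun i G => pderiv i G) F

/-- The `m`-th directional derivative of `F` at `v` in direction `w`
(`m!` times the degree-`m` Taylor form). -/
noncomputable def dirDeriv {n : ℕ} (F : MvPolynomial (Fin n) k)
    (v w : Fin n → k) (m : ℕ) : k :=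
  ∑ s : Fin m → Fin n, eval v (pderivList (List.ofFn s) F) * ∏ j, w (s j)

/-- `F` has multiplicity (exactly) `m` at the point `v`: all partial derivatives of
order `< m` vanish at `v`, while some order-`m` derivative does not. -/
def HasMultiplicityAt {n : ℕ} (F : MvPolynomial (Fin n) k) (v : Fin n → k) (m : ℕ) : Prop :=
  (∀ s : List (Fin n), s.length < m → eval v (pderivList s F) = 0) ∧
    ∃ s : List (Fin n), s.length = m ∧ eval v (pderivList s F) ≠ 0

/-- A singular point of the projective plane curve `F = 0`. -/
def IsSingularAt (F : MvPolynomial (Fin 3) k) (v : Fin 3 → k) : Prop :=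
  v ≠ 0 ∧ eval v F = 0 ∧ ∀ i, eval v (pderiv i F) = 0

/-- A node (ordinary double point): multiplicity two with two distinct tangent
directions, i.e. the degree-2 tangent cone is not (a multiple of) a square of a linear form. -/
def IsNodeAt (F : MvPolynomial (Fin 3) k) (v : Fin 3 → k) : Prop :=
  v ≠ 0 ∧ eval v F = 0 ∧ HasMultiplicityAt F v 2 ∧
    ¬ ∃ (c : k) (l : Fin 3 → k), ∀ w : Fin 3 → k,
        dirDeriv F v w 2 = c * (∑ i, l i * w i) ^ 2

/-- An ordinary point of multiplicity `m`: the degree-`m` tangent cone factors into `m`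
pairwise distinct linear forms. -/
def IsOrdinaryAt (F : MvPolynomial (Fin 3) k) (v : Fin 3 → k) (m : ℕ) : Prop :=
  HasMultiplicityAt F v m ∧
    ∃ (c : k) (L : Fin m → (Fin 3 → k)), c ≠ 0 ∧
      (∀ i j, i ≠ j → ¬ ∃ t : k, L j = t • L i) ∧
      ∀ w : Fin 3 → k, dirDeriv F v w m = c * ∏ i, (∑ j, L i j * w j)

/-- An (irreducible) plane algebraic curve of degree `n` in `ℙ²`. -/
structure PlaneCurve (k : Type) [Field k] where
  n : ℕ
  F : MvPolynomial (Fin 3) k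
  homog : F.IsHomogeneous n
  irred : Irreducible F

/-- Birational equivalence of the projective curves `F = 0` and `G = 0`, expressed by a
pair of mutually inverse rational maps given by homogeneous polynomial triples. -/
def BirEquiv (F G : MvPolynomial (Fin 3) k) : Prop :=
  ∃ φ ψ : Fin 3 → MvPolynomial (Fin 3) k,
    (∃ d, ∀ i, (φ i).IsHomogeneous d) ∧
    (∃ e, ∀ i, (ψ i).IsHomogeneous e) ∧
    bind₁ φ G ∈ Ideal.span {F} ∧
    bind₁ ψ F ∈ Ideal.span {G} ∧
    (∃ lam : MvPolynomial (Fin 3) k, lam ∉ Ideal.span {F} ∧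
      ∀ i, bind₁ φ (ψ i) - lam * X i ∈ Ideal.span {F}) ∧
    (∃ mu : MvPolynomial (Fin 3) k, mu ∉ Ideal.span {G} ∧
      ∀ i, bind₁ ψ (φ i) - mu * X i ∈ Ideal.span {G})

namespace Polynomial.NodalCurve

section Disc
open Polynomial
local notation "Xp" => Polynomial.X
local notation "Cp" => Polynomial.C

lemma dvd_det_one {R : Type*} [CommRing R] {N : Type*} [Fintype N] [DecidableEq N]
    (M : Matrix N N R) (a : R) (i : N) (h : ∀ j, a ∣ M i j) : a ∣ M.det := by
  choose f hf using h
  have : M = M.updateRow i (a • f) := by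
    ext i' j
    by_cases hi : i' = i
    · subst hi; simp [hf]
    · simp [Matrix.updateRow_ne hi]
  rw [this, Matrix.det_updateRow_smul]
  exact Dvd.intro _ rfl

lemma dvd_det_two {R : Type*} [CommRing R] {N : Type*} [Fintype N] [DecidableEq N]
    (M : Matrix N N R) (a b : R) (i i' : N) (hii : i ≠ i') (h : ∀ j, a ∣ M i j)
    (h' : ∀ j, b ∣ M i' j) : a * b ∣ M.det := by
  choose f hf using h
  have : M = M.updateRow i (a • f) := by
    ext i' j
    by_cases hi : i' = i
    · subst hi; simp [hf]
    · simp [Matrix.updateRow_ne hi]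
  rw [this, Matrix.det_updateRow_smul]
  refine mul_dvd_mul_left a (dvd_det_one _ b i' ?_)
  intro j
  rw [Matrix.updateRow_ne hii.symm]
  exact h' j

lemma dvd_res_one {R : Type*} [CommRing R] (f g : R[X]) (m n : ℕ) (hmn : 0 < m + n) (a : R)
    (hf : a ∣ f.coeff 0) (hg : a ∣ g.coeff 0) : a ∣ resultant f g m n := by
  refine dvd_det_one _ a ⟨0, hmn⟩ ?_
  intro j
  induction j using Fin.addCases with
  | left j =>
    simp only [sylvester, Matrix.of_apply, Fin.addCases_left]
    split_ifs with h
    · simpa using hg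
    · simp
  | right j =>
    simp only [sylvester, Matrix.of_apply, Fin.addCases_right]
    split_ifs with h
    · simpa using hf
    · simp

lemma dvd_res_two {R : Type*} [CommRing R] (f g : R[X]) (m n : ℕ) (hmn : 1 < m + n) (a b : R)
    (hf : a ∣ f.coeff 0) (hg : a ∣ g.coeff 0)
    (hf0 : b ∣ f.coeff 0) (hg0 : b ∣ g.coeff 0)
    (hf1 : b ∣ f.coeff 1) (hg1 : b ∣ g.coeff 1) : a * b ∣ resultant f g m n := by
  refine dvd_det_two _ a b ⟨0, by lia⟩ ⟨1, hmn⟩ (by simp) ?_ ?_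
  · intro j
    induction j using Fin.addCases with
    | left j =>
      simp only [sylvester, Matrix.of_apply, Fin.addCases_left]
      split_ifs with h
      · simpa using hg
      · simp
    | right j =>
      simp only [sylvester, Matrix.of_apply, Fin.addCases_right]
      split_ifs with h
      · simpa using hf
      · simp
  · intro j
    have key : ∀ j : ℕ, 1 - j = 0 ∨ 1 - j = 1 := by intro j; lia
    induction j using Fin.addCases with
    | left j =>
      simp only [sylvester, Matrix.of_apply, Fin.addCases_left]
      split_ifs with h
      · rcases key j with h | h <;> simp [h, hg0, hg1]
      · simp
    | right j =>
      simp only [sylvester, Matrix.of_apply, Fin.addCases_right]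
      split_ifs with h
      · rcases key j with h | h <;> simp [h, hf0, hf1]
      · simp

lemma exists_eval_expand {R : Type*} [CommRing R] (q : R[X]) (t : R) :
    ∃ r, q.eval t = q.coeff 0 + q.coeff 1 * t + q.coeff 2 * t ^ 2 + t ^ 3 * r := by
  refine ⟨q.divX.divX.divX.eval t, ?_⟩
  conv_lhs => rw [← divX_mul_X_add q, ← divX_mul_X_add q.divX, ← divX_mul_X_add q.divX.divX]
  simp [coeff_divX]
  ring

lemma cube_dvd_aux {R : Type*} [CommRing R] (x a a1 b b1 b2 c c1 c2 d d1 r e : R)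
    (q0 q1 q2 q3 t z z' : R)
    (h0 : q0 = x ^ 2 * (a + x * a1)) (h1 : q1 = x * (b + x * b1 + x ^ 2 * b2))
    (h2 : q2 = c + x * c1 + x ^ 2 * c2) (h3 : q3 = d + x * d1) (ht : t = r * x + e * x ^ 2)
    (e1 : a + b * r + c * r ^ 2 = 0) (e2 : b + 2 * c * r = 0)
    (e3 : b1 + 2 * c * e + 2 * c1 * r + 3 * d * r ^ 2 = 0) :
    x ^ 3 ∣ q0 + q1 * t + q2 * t ^ 2 + t ^ 3 * z ∧
    x ^ 3 ∣ q1 + (2 * q2) * t + (3 * q3) * t ^ 2 + t ^ 3 * z' := by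
  subst h0 h1 h2 h3 ht
  constructor
  · refine ⟨a1 + (b * e + (b1 + x * b2) * (r + e * x)) + (c * (2 * r * e + e ^ 2 * x)
      + (c1 + x * c2) * (r + e * x) ^ 2) + (r + e * x) ^ 3 * z, ?_⟩
    linear_combination x ^ 2 * e1
  · refine ⟨b2 + 2 * (c1 * e + c2 * (r + e * x)) + 3 * (d * (2 * r * e + e ^ 2 * x)
      + d1 * (r + e * x) ^ 2) + (r + e * x) ^ 3 * z', ?_⟩
    linear_combination x * e2 + x ^ 2 * e3

lemma exists_expand_at {k : Type*} [Field k] (c : k) (p : k[X]) :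
    ∃ p1, p = Cp (p.eval c) + (Xp - Cp c) * p1 := by
  obtain ⟨p1, h⟩ := X_sub_C_dvd_sub_C_eval (a := c) (p := p)
  exact ⟨p1, by rw [← h]; ring⟩

/-- A non-nodal singular point of a monic curve contributes at least three to the discriminant. -/
lemma cube_dvd_res {k : Type*} [Field k] [CharZero k] (q : k[X][X]) (hq : q.Monic) (c : k)
    (al be : k[X]) (h0 : q.coeff 0 = (Xp - Cp c) ^ 2 * al) (h1 : q.coeff 1 = (Xp - Cp c) * be)
    (hh : (be.eval c) ^ 2 = 4 * al.eval c * (q.coeff 2).eval c) :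
    (Xp - Cp c) ^ 3 ∣ resultant q q.derivative := by
  have hx : (Xp - Cp c : k[X]) ≠ 0 := X_sub_C_ne_zero c
  have hnu : ¬ IsUnit (Xp - Cp c : k[X]) := not_isUnit_X_sub_C c
  have hdeg : 2 ≤ q.natDegree := by
    by_contra hlt
    have : q.natDegree = 0 ∨ q.natDegree = 1 := by lia
    rcases this with h | h
    · have := hq.coeff_natDegree
      rw [h, h0] at this
      exact hnu (IsUnit.of_mul_eq_one ((Xp - Cp c) * al) (by rw [← this]; ring))
    · have := hq.coeff_natDegree
      rw [h, h1] at this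
      exact hnu (IsUnit.of_mul_eq_one _ this)
  have hd0 : q.derivative.coeff 0 = q.coeff 1 := by simp [coeff_derivative]
  have hd1 : q.derivative.coeff 1 = 2 * q.coeff 2 := by
    simp [coeff_derivative]; ring
  have hd2 : q.derivative.coeff 2 = 3 * q.coeff 3 := by
    simp [coeff_derivative]; ring
  by_cases hg : (q.coeff 2).eval c = 0
  · have hb : be.eval c = 0 := by
      rw [hg, mul_zero] at hh
      exact pow_eq_zero_iff (two_ne_zero) |>.1 hh
    obtain ⟨b1, hb1⟩ := dvd_iff_isRoot.2 hb
    obtain ⟨g1, hg1⟩ := dvd_iff_isRoot.2 hg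
    have := dvd_res_two q q.derivative q.natDegree q.derivative.natDegree (by lia)
      ((Xp - Cp c) ^ 2) (Xp - Cp c) (h0 ▸ Dvd.intro _ rfl)
      (by rw [hd0, h1, hb1]; exact ⟨b1, by ring⟩)
      (by rw [h0]; exact ⟨(Xp - Cp c) * al, by ring⟩)
      (by rw [hd0, h1]; exact Dvd.intro _ rfl)
      (by rw [h1]; exact Dvd.intro _ rfl)
      (by rw [hd1, hg1]; exact ⟨2 * g1, by ring⟩)
    rw [pow_succ]
    exact this
  · set g := (q.coeff 2).eval c with hgdef
    obtain ⟨a1, ha1⟩ := exists_expand_at c al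
    obtain ⟨b1, hb1⟩ := exists_expand_at c be
    obtain ⟨b2, hb2⟩ := exists_expand_at c b1
    obtain ⟨g1, hg1⟩ := exists_expand_at c (q.coeff 2)
    obtain ⟨g2, hg2⟩ := exists_expand_at c g1
    obtain ⟨d1, hd1'⟩ := exists_expand_at c (q.coeff 3)
    set a := al.eval c
    set b := be.eval c
    set d := (q.coeff 3).eval c
    set r : k := - b / (2 * g) with hr
    set e : k := - (b1.eval c + 2 * g1.eval c * r + 3 * d * r ^ 2) / (2 * g) with he
    have e2 : b + 2 * g * r = 0 := by rw [hr]; field_simp; ring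
    have e1 : a + b * r + g * r ^ 2 = 0 := by
      have h4 : 4 * g * (a + b * r + g * r ^ 2) = 0 := by
        linear_combination (-1) * hh + (b + 2 * g * r) * e2
      have h5 : (4 * g : k) ≠ 0 := mul_ne_zero (by norm_num) hg
      exact (mul_eq_zero.1 h4).resolve_left h5
    have e3 : b1.eval c + 2 * g * e + 2 * g1.eval c * r + 3 * d * r ^ 2 = 0 := by
      rw [he]; field_simp; ring
    set t : k[X] := Cp r * (Xp - Cp c) + Cp e * (Xp - Cp c) ^ 2 with ht
    rw [← resultant_taylor q q.derivative t]
    obtain ⟨z, hz⟩ := exists_eval_expand q t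
    obtain ⟨z', hz'⟩ := exists_eval_expand q.derivative t
    have key := cube_dvd_aux (Xp - Cp c) (Cp a) a1 (Cp b) (Cp (b1.eval c)) b2 (Cp g) (Cp (g1.eval c)) g2
      (Cp d) d1 (Cp r) (Cp e) (q.coeff 0) (q.coeff 1) (q.coeff 2) (q.coeff 3) t z z'
      (by rw [h0]; congr 1)
      (by rw [h1, mul_comm (Xp - Cp c) be]; conv_lhs => rw [hb1, hb2]
          ring)
      (by conv_lhs => rw [hg1, hg2]
          ring)
      hd1' ht
      (by rw [← Polynomial.C_0, ← e1]; simp only [Polynomial.C_add, Polynomial.C_mul, Polynomial.C_pow])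
      (by rw [← Polynomial.C_0, ← e2]; simp only [Polynomial.C_add, Polynomial.C_mul, Polynomial.C_ofNat])
      (by rw [← Polynomial.C_0, ← e3]; simp only [Polynomial.C_add, Polynomial.C_mul, Polynomial.C_pow, Polynomial.C_ofNat])
    refine dvd_res_one _ _ _ _ ?_ _ ?_ ?_
    · rw [natDegree_taylor]; lia
    · rw [taylor_coeff_zero, hz]; exact key.1
    · rw [taylor_coeff_zero, hz', hd0, hd1, hd2]; exact key.2

end Disc
end Polynomial.NodalCurve

namespace Polynomial.NodalCurve

section Smooth
open Polynomial
local notation "Xp" => Polynomial.X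
local notation "Cp" => Polynomial.C

lemma integral_quadratic {R K : Type*} [CommRing R] [Field K] [Algebra R K] (z b c : K)
    (hb : IsIntegral R b) (hc : IsIntegral R c) (h : z ^ 2 + b * z + c = 0) : IsIntegral R z := by
  have hz : IsIntegral (integralClosure R K) z := by
    refine ⟨Xp ^ 2 + (Cp ⟨b, hb⟩ * Xp + Cp ⟨c, hc⟩), ?_, ?_⟩
    · refine monic_X_pow_add ?_
      exact lt_of_le_of_lt degree_linear_le (by norm_num)
    · simp only [eval₂_add, eval₂_mul, eval₂_C, eval₂_X, eval₂_pow]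
      rw [← h]
      simp only [Subalgebra.algebraMap_eq]
      simp
      ring
  exact isIntegral_trans z hz

lemma isIntegral_aeval_of {R K : Type*} [CommRing R] [CommRing K] [Algebra R K] {G : K}
    (hG : IsIntegral R G) (r : R[X]) : IsIntegral R (aeval G r) := by
  have h : G ∈ integralClosure R K := hG
  have := (aeval (⟨G, h⟩ : integralClosure R K) r).2
  rwa [Polynomial.aeval_subalgebra_coe] at this

lemma singular_integral {k K : Type*} [Field k] [Field K] [Algebra k K] [Algebra k[X] K]
    [IsScalarTower k k[X] K] (q : k[X][X]) (hq : q.Monic) (c : k) (al be : k[X])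
    (hW : algebraMap k[X] K (Xp - Cp c) ≠ 0)
    (h0 : q.coeff 0 = (Xp - Cp c) ^ 2 * al) (h1 : q.coeff 1 = (Xp - Cp c) * be)
    (G : K) (hG : aeval G q = 0) :
    ∃ ga : k[X], ga ≠ 0 ∧ ga.natDegree < q.natDegree ∧ ∃ z : K, IsIntegral k[X] z ∧
      aeval G ga = algebraMap k[X] K (Xp - Cp c) * z := by
  have hGi : IsIntegral k[X] G := ⟨q, hq, hG⟩
  set W := algebraMap k[X] K (Xp - Cp c) with hWdef
  set qb : k[X] := q.map (evalRingHom c) with hqb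
  have hqbm : qb.Monic := hq.map _
  have hqb0 : qb.coeff 0 = 0 := by simp [hqb, h0]
  have hqb1 : qb.coeff 1 = 0 := by simp [hqb, h1]
  have hdeg : 0 < q.natDegree := by
    rcases Nat.eq_zero_or_pos q.natDegree with h | h
    · have := hqbm.coeff_natDegree
      rw [hqb, hq.natDegree_map, h, ← hqb, hqb0] at this
      exact absurd this zero_ne_one
    · exact h
  have hqbX : qb = qb.divX * Xp := by
    conv_lhs => rw [← divX_mul_X_add qb, hqb0]
    simp
  have hqbXX : qb.divX = qb.divX.divX * Xp := by
    conv_lhs => rw [← divX_mul_X_add qb.divX, coeff_divX, hqb1]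
    simp
  have hdvd : Cp (Xp - Cp c) ∣ q - qb.map Polynomial.C := by
    rw [C_dvd_iff_dvd_coeff]
    intro i
    rw [coeff_sub, coeff_map, hqb, coeff_map]
    exact X_sub_C_dvd_sub_C_eval
  obtain ⟨de, hde⟩ := hdvd
  have hx : (Xp - Cp c : k[X]) ≠ 0 := X_sub_C_ne_zero c
  have hde0 : de.coeff 0 = (Xp - Cp c) * al := by
    have := congrArg (fun r => r.coeff 0) hde
    simp only [coeff_sub, coeff_map, hqb0, h0, Polynomial.coeff_C_mul] at this
    apply mul_left_cancel₀ hx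
    rw [← this]; simp; ring
  have hde1 : de.coeff 1 = be := by
    have := congrArg (fun r => r.coeff 1) hde
    simp only [coeff_sub, coeff_map, hqb1, h1, Polynomial.coeff_C_mul] at this
    apply mul_left_cancel₀ hx
    rw [← this]; simp
  have hdeG : aeval G de = W * algebraMap k[X] K al + algebraMap k[X] K be * G
      + G ^ 2 * aeval G de.divX.divX := by
    conv_lhs => rw [← divX_mul_X_add de, ← divX_mul_X_add de.divX, coeff_divX, hde0, hde1]
    simp [hWdef]
    ring
  have hqbG : aeval G (qb.map Polynomial.C) = G ^ 2 * aeval G qb.divX.divX := by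
    have : aeval G (qb.map Polynomial.C) = aeval G qb := by
      rw [← Polynomial.algebraMap_eq, aeval_map_algebraMap]
    rw [this]
    conv_lhs => rw [hqbX, hqbXX]
    simp
    ring
  have hmain : G ^ 2 * aeval G qb.divX.divX + W * aeval G de = 0 := by
    have := congrArg (aeval G) hde
    rw [map_sub, hG, map_mul, aeval_C, hqbG] at this
    linear_combination (-1) * this
  refine ⟨qb.divX, ?_, ?_, G * aeval G qb.divX.divX / W, ?_, ?_⟩
  · intro h
    rw [h, zero_mul] at hqbX
    exact hqbm.ne_zero hqbX
  · rw [natDegree_divX_eq_natDegree_tsub_one, hqb, hq.natDegree_map]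
    lia
  · have hIntegral : ∀ r : k[X][X], IsIntegral k[X] (aeval G r) := by
      intro r
      exact isIntegral_aeval_of hGi r
    have hIntegral' : ∀ r : k[X], IsIntegral k[X] (aeval G r) := by
      intro r
      rw [← aeval_map_algebraMap k[X] G r]
      exact hIntegral _
    refine integral_quadratic _ (algebraMap k[X] K be + G * aeval G de.divX.divX)
      (aeval G qb.divX.divX * algebraMap k[X] K al)
      (isIntegral_algebraMap.add (hGi.mul (hIntegral _)))
      ((hIntegral' _).mul isIntegral_algebraMap) ?_
    rw [hdeG] at hmain
    field_simp
    linear_combination (aeval G qb.divX.divX) * hmain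
  · conv_lhs => rw [hqbXX]
    field_simp
    simp
    ring

/-- `(c, b)` is a singular point of the affine curve `p(x, T) = 0`. -/
def Sing {k : Type*} [Field k] (p : k[X][X]) (c b : k) : Prop :=
  (p.eval (Cp b)).eval c = 0 ∧ ((p.eval (Cp b)).derivative).eval c = 0 ∧
    (p.derivative.eval (Cp b)).eval c = 0

/-- The Hessian degenerates. -/
def DegHess {k : Type*} [Field k] (p : k[X][X]) (c b : k) : Prop :=
  (((p.derivative.eval (Cp b)).derivative).eval c) ^ 2 =
    (((p.eval (Cp b)).derivative.derivative).eval c) *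
      ((p.derivative.derivative.eval (Cp b)).eval c)

lemma Sing.exists_al {k : Type*} [Field k] {p : k[X][X]} {c b : k} (h : Sing p c b) :
    ∃ al be : k[X], (taylor (Cp b) p).coeff 0 = (Xp - Cp c) ^ 2 * al ∧
      (taylor (Cp b) p).coeff 1 = (Xp - Cp c) * be := by
  obtain ⟨h1, h2, h3⟩ := h
  obtain ⟨a, ha⟩ := dvd_iff_isRoot.2 h1
  obtain ⟨be, hbe⟩ := dvd_iff_isRoot.2 h3
  have : a.eval c = 0 := by
    rw [ha] at h2
    simpa using h2
  obtain ⟨al, hal⟩ := dvd_iff_isRoot.2 this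
  refine ⟨al, be, ?_, ?_⟩
  · rw [taylor_coeff_zero, ha, hal]; ring
  · rw [taylor_coeff_one, hbe]

lemma not_sing_of_indep {k K : Type*} [Field k] [Field K] [Algebra k K] [Algebra k[X] K]
    [IsScalarTower k k[X] K] (p : k[X][X]) (hp : p.Monic) (c b : k)
    (hW : algebraMap k[X] K (Xp - Cp c) ≠ 0) (g : K) (hg : aeval g p = 0)
    (hind : ∀ r : k[X], r.natDegree < p.natDegree → ∀ z : K, IsIntegral k[X] z →
      aeval g r = algebraMap k[X] K (Xp - Cp c) * z → r = 0) : ¬ Sing p c b := by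
  intro h
  obtain ⟨al, be, h0, h1⟩ := h.exists_al
  obtain ⟨ga, hga, hdeg, z, hz, hzz⟩ := singular_integral (taylor (Cp b) p)
    (by rw [Monic, leadingCoeff_taylor]; exact hp) c al be hW h0 h1
    (g - algebraMap k K b) (by
      rw [taylor_apply, aeval_comp]
      simp only [map_add, aeval_X, aeval_C]
      rw [← Polynomial.algebraMap_eq, ← IsScalarTower.algebraMap_apply]
      simpa using hg)
  rw [natDegree_taylor] at hdeg
  have := hind (taylor (-b) ga) (by rwa [natDegree_taylor]) z hz (by
    rw [← hzz, taylor_apply, aeval_comp]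
    simp [sub_eq_add_neg])
  apply hga
  exact taylor_injective (-b) (by rw [this]; simp)

lemma cube_dvd_of_degHess {k : Type*} [Field k] [CharZero k] (p : k[X][X]) (hp : p.Monic)
    (c b : k) (h : Sing p c b) (hd : DegHess p c b) :
    (Xp - Cp c) ^ 3 ∣ resultant p p.derivative := by
  obtain ⟨al, be, h0, h1⟩ := h.exists_al
  have hder : taylor (Cp b) p.derivative = (taylor (Cp b) p).derivative := by
    simp [taylor_apply, derivative_comp]
  rw [← resultant_taylor p p.derivative (Cp b), hder]
  refine cube_dvd_res _ (by rw [Monic, leadingCoeff_taylor]; exact hp) c al be h0 h1 ?_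
  unfold DegHess at hd
  rw [taylor_coeff_zero] at h0
  rw [taylor_coeff_one] at h1
  have h2 : (p.derivative.derivative.eval (Cp b)) = 2 * (taylor (Cp b) p).coeff 2 := by
    rw [← taylor_coeff_one, hder, coeff_derivative]
    norm_num
    ring
  rw [h0, h1, h2] at hd
  simp [derivative_pow, pow_two] at hd
  linear_combination hd

end Smooth
end Polynomial.NodalCurve

namespace Polynomial.NodalCurve

section Bertini
open Polynomial

/-- Squarefreeness passes to the fraction field (Gauss). -/
lemma squarefree_map_fraction {R : Type*} [CommRing R] [IsDomain R] [UniqueFactorizationMonoid R]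
    (K : Type*) [Field K] [Algebra R K] [IsFractionRing R K] (J : R[X]) (hJ0 : J ≠ 0)
    (hJ : Squarefree J) : Squarefree (J.map (algebraMap R K)) := by
  classical
  let _ : NormalizedGCDMonoid R := Classical.choice inferInstance
  intro q hq
  have hq0 : q ≠ 0 := by
    rintro rfl
    rw [zero_mul, zero_dvd_iff, Polynomial.map_eq_zero_iff (IsFractionRing.injective R K)] at hq
    exact hJ0 hq
  apply isUnit_or_eq_zero_of_isUnit_integerNormalization_primPart (R := R) hq0
  set N := IsLocalization.integerNormalization (nonZeroDivisors R) q with hN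
  obtain ⟨c, c0, hc⟩ := IsLocalization.integerNormalization_spec (nonZeroDivisors R) q
  apply hJ
  have hprim : (N.primPart * N.primPart).IsPrimitive :=
    (isPrimitive_primPart N).mul (isPrimitive_primPart N)
  apply hprim.dvd_of_fraction_map_dvd_fraction_map (K := K)
  refine dvd_trans ?_ hq
  have h1 : N.primPart.map (algebraMap R K) ∣ q := by
    have h2 : N.primPart.map (algebraMap R K) ∣ N.map (algebraMap R K) :=
      Polynomial.map_dvd _ (primPart_dvd N)
    rw [hc, Algebra.smul_def, algebraMap_apply] at h2
    have hu : IsUnit (C (algebraMap R K c)) := by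
      rw [isUnit_C, isUnit_iff_ne_zero]
      exact IsFractionRing.to_map_ne_zero_of_mem_nonZeroDivisors c0
    exact (hu.dvd_mul_left).1 h2
  rw [Polynomial.map_mul]
  exact mul_dvd_mul h1 h1

lemma exists_bezout {R : Type*} [CommRing R] [IsDomain R] [UniqueFactorizationMonoid R]
    [CharZero R] (J : R[X]) (hJ0 : J ≠ 0) (hJ : Squarefree J) :
    ∃ r : R, r ≠ 0 ∧ ∃ a b : R[X], J * a + J.derivative * b = C r := by
  by_cases hd : J.natDegree = 0
  · obtain ⟨a, rfl⟩ := natDegree_eq_zero.1 hd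
    exact ⟨a, fun h => hJ0 (by simp [h]), 1, 0, by simp⟩
  · have : CharZero (FractionRing R) :=
      charZero_of_injective_algebraMap (IsFractionRing.injective R (FractionRing R))
    have hs := PerfectField.separable_iff_squarefree.2
      (squarefree_map_fraction (FractionRing R) J hJ0 hJ)
    obtain ⟨p, q, -, -, h⟩ := exists_mul_add_mul_eq_C_resultant J J.derivative le_rfl le_rfl
      (Or.inl hd)
    refine ⟨_, ?_, p, q, h⟩
    intro h0
    have hinj := IsFractionRing.injective R (FractionRing R)
    have h1 := resultant_map_map J J.derivative J.natDegree J.derivative.natDegree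
      (algebraMap R (FractionRing R))
    rw [h0, map_zero] at h1
    have h2 : resultant (J.map (algebraMap R (FractionRing R)))
       (J.derivative.map (algebraMap R (FractionRing R))) = 0 := by
      rw [natDegree_map_eq_of_injective hinj, natDegree_map_eq_of_injective hinj]; exact h1
    rw [resultant_eq_zero_iff] at h2
    apply h2.2
    rw [← derivative_map]
    exact hs

/-- The ring isomorphism exchanging variables. -/
noncomputable def swapEquiv (ι k : Type*) [CommRing k] :
    MvPolynomial ι k[X] ≃ₐ[k] Polynomial (MvPolynomial ι k) :=
  (MvPolynomial.optionEquivRight k ι).symm.trans (MvPolynomial.optionEquivLeft k ι)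

lemma swapEquiv_X {ι k : Type*} [CommRing k] (i : ι) :
    swapEquiv ι k (MvPolynomial.X i) = C (MvPolynomial.X i) := by
  rw [swapEquiv, AlgEquiv.trans_apply, ← MvPolynomial.optionEquivRight_X_some k, AlgEquiv.symm_apply_apply,
    MvPolynomial.optionEquivLeft_X_some]

lemma swapEquiv_C_X {ι k : Type*} [CommRing k] :
    swapEquiv ι k (MvPolynomial.C X) = X := by
  rw [swapEquiv, AlgEquiv.trans_apply, ← MvPolynomial.optionEquivRight_X_none k, AlgEquiv.symm_apply_apply,
    MvPolynomial.optionEquivLeft_X_none]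

lemma swapEquiv_C_C {ι k : Type*} [CommRing k] (a : k) :
    swapEquiv ι k (MvPolynomial.C (C a)) = C (MvPolynomial.C a) := by
  rw [swapEquiv, AlgEquiv.trans_apply, ← MvPolynomial.optionEquivRight_C k, AlgEquiv.symm_apply_apply,
    MvPolynomial.optionEquivLeft_C]

lemma map_eval_swapEquiv {ι k : Type*} [CommRing k] (t : ι → k) (I : MvPolynomial ι k[X]) :
    (swapEquiv ι k I).map (MvPolynomial.eval t) = MvPolynomial.eval (fun i => C (t i)) I := by
  have : ((mapRingHom (MvPolynomial.eval t)).comp (swapEquiv ι k).toRingEquiv.toRingHom) =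
      MvPolynomial.eval (fun i => C (t i)) := by
    apply MvPolynomial.ringHom_ext
    · intro p
      have h2 : ((mapRingHom (MvPolynomial.eval t)).comp
          (swapEquiv ι k).toRingEquiv.toRingHom).comp MvPolynomial.C = RingHom.id _ := by
        apply Polynomial.ringHom_ext
        · intro a
          simp [swapEquiv_C_C]
        · simp [swapEquiv_C_X]
      have h3 := RingHom.congr_fun h2 p
      rw [MvPolynomial.eval_C]
      exact h3
    · intro i
      simp [swapEquiv_X]
  exact RingHom.congr_fun this I

/-- The Bertini type lemma. -/
lemma bertini {ι k Ω : Type*} [Finite ι] [Field k] [IsAlgClosed k] [CharZero k] [Field Ω]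
    (φ : k[X] →+* Ω)
    (hφ : Function.Injective φ) (I : MvPolynomial ι k[X])
    (h1 : ∀ c : k, MvPolynomial.map (evalRingHom c) I ≠ 0)
    (h2 : Squarefree (MvPolynomial.map φ I)) (D : k[X]) (hD : D ≠ 0) :
    ∃ r : MvPolynomial ι k, r ≠ 0 ∧ ∀ t : ι → k, MvPolynomial.eval t r ≠ 0 → ∀ c : k,
      (MvPolynomial.eval (fun i => C (t i)) I).eval c = 0 →
        D.eval c ≠ 0 ∧ (MvPolynomial.eval (fun i => C (t i)) I).derivative.eval c ≠ 0 := by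
  classical
  have hI0 : I ≠ 0 := by
    rintro rfl
    exact h1 0 (by simp)
  have hsq : Squarefree I := by
    intro q hq
    have hu : IsUnit (MvPolynomial.map φ q) := by
      apply h2
      rw [← map_mul]
      exact _root_.map_dvd _ hq
    rw [MvPolynomial.isUnit_iff_eq_C_of_isReduced] at hu
    obtain ⟨s, hs, hqs⟩ := hu
    have hqC : q = MvPolynomial.C (q.coeff 0) := by
      apply MvPolynomial.map_injective φ hφ
      rw [MvPolynomial.map_C, hqs]
      congr 1
      have := congrArg (MvPolynomial.coeff 0) hqs
      rw [MvPolynomial.coeff_map, MvPolynomial.coeff_C] at this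
      simpa using this.symm
    rw [hqC]
    apply IsUnit.map
    by_contra hnu
    set a := q.coeff 0 with ha
    have hdeg : a.degree ≠ 0 := by
      intro h
      exact hnu (isUnit_iff_degree_eq_zero.2 h)
    obtain ⟨c, hc⟩ := IsAlgClosed.exists_root a hdeg
    apply h1 c
    obtain ⟨z, hz⟩ := hq
    rw [hz, hqC]
    simp only [map_mul, MvPolynomial.map_C]
    have : evalRingHom c a = 0 := hc
    simp [this]
  set J := swapEquiv ι k I with hJ
  have hJ0 : J ≠ 0 := by
    intro h
    exact hI0 ((swapEquiv ι k).injective (by rw [← hJ, h, map_zero]))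
  have hJs : Squarefree J := by
    intro q hq
    have h3 := hsq ((swapEquiv ι k).symm q) (by
      rw [← map_mul]
      have := _root_.map_dvd (swapEquiv ι k).symm hq
      rwa [hJ, AlgEquiv.symm_apply_apply] at this)
    have := h3.map (swapEquiv ι k)
    rwa [AlgEquiv.apply_symm_apply] at this
  obtain ⟨r, hr0, a, b, hab⟩ := exists_bezout J hJ0 hJs
  refine ⟨r * ∏ c ∈ D.roots.toFinset, MvPolynomial.map (evalRingHom c) I, ?_, ?_⟩
  · exact mul_ne_zero hr0 (Finset.prod_ne_zero_iff.2 fun c _ => h1 c)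
  · intro t ht c hc
    rw [map_mul, map_prod] at ht
    constructor
    · intro hDc
      apply ht
      rw [Finset.prod_eq_zero (i := c), mul_zero]
      · simp [hD, hDc]
      · rw [← hc, MvPolynomial.eval_map]
        change MvPolynomial.eval₂ (evalRingHom c) t I = evalRingHom c _
        rw [← MvPolynomial.eval₂_id, MvPolynomial.hom_eval₂]
        congr 1
        funext i
        simp
    · intro hc'
      have h5 := congrArg (fun f => (f.map (MvPolynomial.eval t)).eval c) hab
      simp only [Polynomial.map_add, Polynomial.map_mul, ← derivative_map, map_C, eval_C] at h5
      rw [hJ, map_eval_swapEquiv, eval_add, eval_mul, eval_mul, hc, hc'] at h5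
      simp at h5
      exact ht (by rw [← h5, zero_mul])

end Bertini
end Polynomial.NodalCurve

namespace Polynomial.NodalCurve

section Krylov

variable {R A ι : Type*} [CommRing R] [CommRing A] [Algebra R A] [Fintype ι] {n : ℕ}

/-- Generic multiplication matrix. -/
noncomputable def genMat (e : Module.Basis (Fin n) R A) (v : ι → A) :
    Matrix (Fin n) (Fin n) (MvPolynomial ι R) :=
  ∑ l, (MvPolynomial.X l : MvPolynomial ι R) •
    (Algebra.leftMulMatrix e (v l)).map (MvPolynomial.C : R →+* MvPolynomial ι R)

noncomputable def kry (e : Module.Basis (Fin n) R A) (v : ι → A) :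
    Matrix (Fin n) (Fin n) (MvPolynomial ι R) :=
  Matrix.of fun i j => (((genMat e v) ^ (j : ℕ)).mulVec (fun i => MvPolynomial.C (e.repr 1 i))) i

/-- The index polynomial. -/
noncomputable def idx (e : Module.Basis (Fin n) R A) (v : ι → A) : MvPolynomial ι R :=
  (kry e v).det

lemma eval_idx (e : Module.Basis (Fin n) R A) (v : ι → A) (t : ι → R) :
    MvPolynomial.eval t (idx e v) =
      (Matrix.of fun i j : Fin n => e.repr ((∑ l, t l • v l) ^ (j : ℕ)) i).det := by
  rw [idx, RingHom.map_det]
  congr 1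
  set g := ∑ l, t l • v l with hg
  have hM : (genMat e v).map (MvPolynomial.eval t) = Algebra.leftMulMatrix e g := by
    rw [hg, map_sum]
    ext i j
    simp [genMat, Matrix.sum_apply]
  have hMj : ∀ j : ℕ, (genMat e v ^ j).map (MvPolynomial.eval t) = Algebra.leftMulMatrix e (g ^ j) := by
    intro j
    rw [Matrix.map_pow, hM, map_pow]
  ext i j
  simp only [RingHom.mapMatrix_apply, Matrix.map_apply, kry, Matrix.of_apply]
  rw [RingHom.map_mulVec, hMj]
  have : (MvPolynomial.eval t ∘ fun i => (MvPolynomial.C (e.repr 1 i) : MvPolynomial ι R)) = e.repr 1 := by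
    funext i; simp
  rw [this, Algebra.leftMulMatrix_mulVec_repr, mul_one]

lemma map_idx {Ω : Type*} [CommRing Ω] (φ : R →+* Ω) (σ : Fin n → (A →+* Ω))
    (hσ : ∀ a r, σ a (algebraMap R A r) = φ r)
    (e : Module.Basis (Fin n) R A) (v : ι → A) :
    MvPolynomial.C ((Matrix.of fun a i : Fin n => σ a (e i)).det) * MvPolynomial.map φ (idx e v) =
      ∏ i : Fin n, ∏ j ∈ Finset.Ioi i,
        ((∑ l, MvPolynomial.C (σ j (v l)) * MvPolynomial.X l : MvPolynomial ι Ω) -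
          ∑ l, MvPolynomial.C (σ i (v l)) * MvPolynomial.X l) := by
  rw [← Matrix.det_vandermonde, idx, RingHom.map_det, RingHom.map_det, ← Matrix.det_mul]
  congr 1
  have hσs : ∀ a (r : R) (x : A), σ a (r • x) = φ r * σ a x := by
    intro a r x; rw [Algebra.smul_def, map_mul, hσ]
  have key : ∀ a : Fin n, Matrix.vecMul (fun i => (MvPolynomial.C (σ a (e i)) : MvPolynomial ι Ω))
      ((genMat e v).map (MvPolynomial.map φ)) =
      (∑ l, MvPolynomial.C (σ a (v l)) * MvPolynomial.X l) •
        (fun i => (MvPolynomial.C (σ a (e i)) : MvPolynomial ι Ω)) := by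
    intro a
    funext j
    have h1 : ∀ l, σ a (v l) * σ a (e j) =
        ∑ i, σ a (e i) * φ (Algebra.leftMulMatrix e (v l) i j) := by
      intro l
      rw [← map_mul, ← e.sum_repr (v l * e j), map_sum]
      refine Finset.sum_congr rfl fun i _ => ?_
      rw [hσs, Algebra.leftMulMatrix_eq_repr_mul, mul_comm]
    simp only [Matrix.vecMul, dotProduct, Matrix.map_apply, genMat, Matrix.sum_apply,
      Matrix.smul_apply, map_sum, smul_eq_mul, map_mul, MvPolynomial.map_X, MvPolynomial.map_C,
      Pi.smul_apply, Finset.mul_sum, Finset.sum_mul]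
    rw [Finset.sum_comm]
    refine Finset.sum_congr rfl fun l _ => ?_
    rw [mul_right_comm, ← map_mul, h1, map_sum, Finset.sum_mul]
    refine Finset.sum_congr rfl fun i _ => ?_
    rw [map_mul]; ring
  have keyj : ∀ (j : ℕ) (a : Fin n), Matrix.vecMul (fun i => (MvPolynomial.C (σ a (e i)) : MvPolynomial ι Ω))
      (((genMat e v).map (MvPolynomial.map φ)) ^ j) =
      (∑ l, MvPolynomial.C (σ a (v l)) * MvPolynomial.X l) ^ j •
        (fun i => (MvPolynomial.C (σ a (e i)) : MvPolynomial ι Ω)) := by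
    intro j a
    induction j with
    | zero => simp
    | succ j ih =>
      rw [pow_succ, ← Matrix.vecMul_vecMul, ih, Matrix.smul_vecMul, key, smul_smul, pow_succ]
  ext1 a j
  rw [Matrix.mul_apply, Matrix.vandermonde_apply]
  simp only [RingHom.mapMatrix_apply, Matrix.map_apply, kry, Matrix.of_apply]
  have h2 : ∀ i, MvPolynomial.map φ (((genMat e v) ^ (j : ℕ)).mulVec
      (fun i => MvPolynomial.C (e.repr 1 i)) i) =
      ((((genMat e v).map (MvPolynomial.map φ)) ^ (j : ℕ)).mulVec
        (fun i => MvPolynomial.C (φ (e.repr 1 i)))) i := by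
    intro i
    rw [RingHom.map_mulVec, Matrix.map_pow]
    congr 1
    congr 1
    funext i; simp
  simp only [h2]
  change dotProduct (fun i => (MvPolynomial.C (σ a (e i)) : MvPolynomial ι Ω)) (Matrix.mulVec _ _) = _
  rw [Matrix.dotProduct_mulVec, keyj, smul_dotProduct]
  have h3 : dotProduct (fun i => (MvPolynomial.C (σ a (e i)) : MvPolynomial ι Ω))
      (fun i => MvPolynomial.C (φ (e.repr 1 i))) = 1 := by
    rw [dotProduct]
    have h4 : ∑ i, σ a (e i) * φ (e.repr 1 i) = 1 := by
      conv_rhs => rw [← map_one (σ a), ← e.sum_repr (1 : A), map_sum]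
      refine Finset.sum_congr rfl fun i _ => ?_
      rw [hσs, mul_comm]
    rw [← map_one (MvPolynomial.C : Ω →+* MvPolynomial ι Ω), ← h4, map_sum]
    refine Finset.sum_congr rfl fun i _ => ?_
    rw [map_mul]
  rw [h3]
  simp

end Krylov

section FourPoint

lemma four_point {A Ω : Type*} [CommRing A] [Field Ω] (S : Set A) (h1S : 1 ∈ S)
    (x1 x2 x3 x4 : A →+* Ω) (l2 l3 l4 : Ω)
    (h : ∀ a ∈ S, ∀ b ∈ S, ∀ c ∈ S,
      x1 (a * b * c) + l2 * x2 (a * b * c) + l3 * x3 (a * b * c) + l4 * x4 (a * b * c) = 0)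
    (h2 : ∃ a ∈ S, x1 a ≠ x2 a) (h3 : ∃ a ∈ S, x1 a ≠ x3 a) (h4 : ∃ a ∈ S, x1 a ≠ x4 a) :
    False := by
  obtain ⟨a, ha, ha'⟩ := h2
  obtain ⟨b, hb, hb'⟩ := h3
  obtain ⟨c, hc, hc'⟩ := h4
  have e1 := h a ha b hb c hc
  have e2 := h a ha b hb 1 h1S
  have e3 := h a ha 1 h1S c hc
  have e4 := h a ha 1 h1S 1 h1S
  have e5 := h 1 h1S b hb c hc
  have e6 := h 1 h1S b hb 1 h1S
  have e7 := h 1 h1S 1 h1S c hc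
  have e8 := h 1 h1S 1 h1S 1 h1S
  simp only [map_mul, map_one, one_mul, mul_one] at e1 e2 e3 e4 e5 e6 e7 e8
  have : (x1 a - x2 a) * (x1 b - x3 b) * (x1 c - x4 c) = 0 := by
    linear_combination e1 - x4 c * e2 - x3 b * e3 + x3 b * x4 c * e4 - x2 a * e5
      + x2 a * x4 c * e6 + x2 a * x3 b * e7 - x2 a * x3 b * x4 c * e8
  simp only [mul_eq_zero, sub_eq_zero] at this
  tauto

end FourPoint
end Polynomial.NodalCurve

namespace Polynomial.NodalCurve

section LinForms
variable {ι Ω : Type*} [Fintype ι] [Field Ω]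

noncomputable def linForm (c : ι → Ω) : MvPolynomial ι Ω :=
  ∑ l, MvPolynomial.C (c l) * MvPolynomial.X l

lemma coeff_linForm (c : ι → Ω) (l : ι) : (linForm c).coeff (Finsupp.single l 1) = c l := by
  classical
  rw [linForm, MvPolynomial.coeff_sum]
  simp [MvPolynomial.coeff_C_mul, MvPolynomial.coeff_X', Finsupp.single_left_inj]

lemma irreducible_linForm (c : ι → Ω) (hc : c ≠ 0) : Irreducible (linForm c) := by
  obtain ⟨l, hl⟩ := Function.ne_iff.1 hc
  have hne : (linForm c).coeff (Finsupp.single l 1) ≠ 0 := by rwa [coeff_linForm]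
  have hh : (linForm c).IsHomogeneous 1 := by
    apply MvPolynomial.IsHomogeneous.sum
    intro l _
    have := (MvPolynomial.isHomogeneous_C ι (c l)).mul (MvPolynomial.isHomogeneous_X Ω l)
    simpa using this
  have hne0 : linForm c ≠ 0 := by
    intro h; rw [h] at hne; simp at hne
  apply MvPolynomial.irreducible_of_totalDegree_eq_one (hh.totalDegree hne0)
  intro x hx
  rw [isUnit_iff_ne_zero]
  rintro rfl
  exact hne (zero_dvd_iff.1 (hx _))

lemma isRelPrime_linForm (c d : ι → Ω) (hc : c ≠ 0) (hd : d ≠ 0)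
    (h : ∀ s : Ω, c ≠ s • d) : IsRelPrime (linForm c) (linForm d) := by
  rw [(irreducible_linForm c hc).isRelPrime_iff_not_dvd]
  intro hdvd
  obtain ⟨u, hu⟩ := (((irreducible_linForm c hc).dvd_irreducible_iff_associated (irreducible_linForm d hd)).1 hdvd).symm
  have h1 := u.isUnit
  rw [MvPolynomial.isUnit_iff_eq_C_of_isReduced] at h1
  obtain ⟨s, -, hs⟩ := h1
  apply h s
  funext l
  rw [← coeff_linForm c l, ← hu, hs, mul_comm, MvPolynomial.coeff_C_mul, coeff_linForm]
  rfl

end LinForms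

section Sqf

variable {k A ι Ω : Type*} [Field k] [CommRing A] [Algebra k A] [Fintype ι]  [Field Ω] {n : ℕ}

lemma squarefree_prod_forms (S : Set A) (h1S : 1 ∈ S) (v : ι → A)
    (hv : ∀ a ∈ S, ∀ b ∈ S, ∀ c ∈ S, ∃ l, v l = a * b * c)
    (σ : Fin n → (A →+* Ω))
    (hσ : ∀ i j, i ≠ j → ∃ a ∈ S, σ i a ≠ σ j a) :
    Squarefree (∏ i : Fin n, ∏ j ∈ Finset.Ioi i,
        ((∑ l, MvPolynomial.C (σ j (v l)) * MvPolynomial.X l : MvPolynomial ι Ω) -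
          ∑ l, MvPolynomial.C (σ i (v l)) * MvPolynomial.X l)) := by
  classical
  have hL : ∀ i j, ((∑ l, MvPolynomial.C (σ j (v l)) * MvPolynomial.X l : MvPolynomial ι Ω) -
          ∑ l, MvPolynomial.C (σ i (v l)) * MvPolynomial.X l) =
        linForm (fun l => σ j (v l) - σ i (v l)) := by
    intro i j
    rw [linForm, ← Finset.sum_sub_distrib]
    refine Finset.sum_congr rfl fun l _ => ?_
    rw [map_sub, sub_mul]
  simp only [hL]
  rw [Finset.prod_sigma' (f := fun i j => linForm (fun l => σ j (v l) - σ i (v l)))]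
  have hne : ∀ i j, i ≠ j → (fun l => σ j (v l) - σ i (v l)) ≠ 0 := by
    intro i j hij h
    obtain ⟨a, ha, ha'⟩ := hσ i j hij
    obtain ⟨l, hl⟩ := hv 1 h1S 1 h1S a ha
    have := congrFun h l
    rw [hl] at this
    simp [sub_eq_zero] at this
    exact ha' this.symm
  apply Finset.squarefree_prod_of_pairwise_isCoprime
  · rintro ⟨i, j⟩ hij ⟨i', j'⟩ hij' hne'
    simp at hij hij'
    change IsRelPrime (linForm (fun l => σ j (v l) - σ i (v l))) (linForm (fun l => σ j' (v l) - σ i' (v l)))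
    apply isRelPrime_linForm _ _ (hne _ _ hij.ne) (hne _ _ hij'.ne)
    intro s hs
    have key : ∀ a ∈ S, ∀ b ∈ S, ∀ c ∈ S, σ j (a * b * c) - σ i (a * b * c) =
        s * (σ j' (a * b * c) - σ i' (a * b * c)) := by
      intro a ha b hb c hc
      obtain ⟨l, hl⟩ := hv a ha b hb c hc
      rw [← hl]
      exact congrFun hs l
    by_cases hj : j ≠ j' ∧ j ≠ i'
    · exact four_point S h1S (σ j) (σ i) (σ j') (σ i') (-1) (-s) s
        (fun a ha b hb c hc => by linear_combination key a ha b hb c hc)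
        (hσ _ _ hij.ne') (hσ _ _ hj.1) (hσ _ _ hj.2)
    · by_cases hi : i ≠ j' ∧ i ≠ i'
      · exact four_point S h1S (σ i) (σ j) (σ j') (σ i') (-1) s (-s)
          (fun a ha b hb c hc => by linear_combination -key a ha b hb c hc)
          (hσ _ _ hij.ne) (hσ _ _ hi.1) (hσ _ _ hi.2)
      · apply hne'
        have : i = i' ∧ j = j' := by
          simp only [Fin.ext_iff, Fin.lt_def] at *
          omega
        obtain ⟨rfl, rfl⟩ := this
        rfl
  · rintro ⟨i, j⟩ hij
    simp at hij
    exact (irreducible_linForm _ (hne _ _ hij.ne)).squarefree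

end Sqf
end Polynomial.NodalCurve

namespace Polynomial.NodalCurve

section IndepSec
open Polynomial

variable {k A : Type*} [Field k] [CommRing A] [Algebra k A] [Algebra k[X] A]
  [IsScalarTower k k[X] A]

/-- Powers of `g` are independent modulo `X - c`. -/
def Indep (n : ℕ) (g : A) (c : k) : Prop :=
  ∀ r : k[X], r.natDegree < n → ∀ z : A, aeval g r = algebraMap k[X] A (X - C c) * z → r = 0

lemma repr_aeval {n : ℕ} (e : Module.Basis (Fin n) k[X] A) (g : A) (r : k[X])
    (hr : r.natDegree < n) (i : Fin n) :
    e.repr (aeval g r) i = ∑ j : Fin n, C (r.coeff j) * e.repr (g ^ (j : ℕ)) i := by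
  rw [aeval_eq_sum_range' hr, Finset.sum_range (fun i => r.coeff i • g ^ i), map_sum,
    Finsupp.finsetSum_apply]
  refine Finset.sum_congr rfl fun j _ => ?_
  rw [← IsScalarTower.algebraMap_smul k[X] (r.coeff j), map_smul]
  rfl

lemma indep_iff {n : ℕ} (e : Module.Basis (Fin n) k[X] A) (g : A) (c : k) :
    (Matrix.of fun i j : Fin n => e.repr (g ^ (j : ℕ)) i).det.eval c ≠ 0 ↔ Indep n g c := by
  set M := (Matrix.of fun i j : Fin n => e.repr (g ^ (j : ℕ)) i) with hM
  have hdet : M.det.eval c = (M.map (evalRingHom c)).det := by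
    change evalRingHom c M.det = _
    rw [RingHom.map_det]; rfl
  have hmul : ∀ (r : k[X]) (_ : r.natDegree < n) (i : Fin n),
      ((M.map (evalRingHom c)).mulVec (fun j => r.coeff j)) i = (e.repr (aeval g r) i).eval c := by
    intro r hr i
    rw [repr_aeval e g r hr, Matrix.mulVec, dotProduct, eval_finsetSum]
    refine Finset.sum_congr rfl fun j _ => ?_
    simp [hM, mul_comm]
  rw [hdet]
  constructor
  · intro h r hr z hz
    have h0 : (M.map (evalRingHom c)).mulVec (fun j => r.coeff j) = 0 := by
      funext i
      rw [hmul r hr, hz, ← Algebra.smul_def, map_smul]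
      simp
    have h1 := Matrix.eq_zero_of_mulVec_eq_zero h h0
    ext j
    by_cases hj : j < n
    · simpa using congrFun h1 ⟨j, hj⟩
    · rw [coeff_eq_zero_of_natDegree_lt (by lia)]; simp
  · intro h h0
    obtain ⟨mu, hmu, hmu0⟩ := Matrix.exists_mulVec_eq_zero_iff.2 h0
    obtain ⟨j0, hj0⟩ := Function.ne_iff.1 hmu
    set r : k[X] := ∑ j : Fin n, C (mu j) * X ^ (j : ℕ) with hr
    have hcoeff : ∀ j : Fin n, r.coeff j = mu j := by
      intro j
      rw [hr, finsetSum_coeff]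
      simp [coeff_C_mul, coeff_X_pow, ← Fin.ext_iff]
    have hdeg : r.natDegree < n := by
      have hn : 0 < n := lt_of_le_of_lt (Nat.zero_le _) j0.2
      have h5 : r.natDegree ≤ n - 1 := by
        apply natDegree_sum_le_of_forall_le
        intro j _
        refine (natDegree_C_mul_X_pow_le _ _).trans ?_
        have := j.2
        lia
      lia
    have hdvd : ∀ i, (X - C c) ∣ e.repr (aeval g r) i := by
      intro i
      rw [dvd_iff_isRoot, IsRoot, ← hmul r hdeg]
      simp only [hcoeff]
      exact congrFun hmu0 i
    choose z hz using hdvd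
    have hr0 := h r hdeg (∑ i, z i • e i) (by
      rw [← Algebra.smul_def, Finset.smul_sum, ← e.sum_repr (aeval g r)]
      refine Finset.sum_congr rfl fun i _ => ?_
      rw [hz, smul_smul])
    apply hj0
    rw [← hcoeff, hr0]; simp

end IndepSec

section Points
open Polynomial
variable {k A : Type*} [Field k] [IsAlgClosed k] [CommRing A] [Algebra k A] [Algebra k[X] A]
  [IsScalarTower k k[X] A]

lemma exists_char [Algebra.IsIntegral k[X] A] (c : k) (P : Ideal A) [P.IsPrime]
    (hP : algebraMap k[X] A (X - C c) ∈ P) : ∃ x : A →ₐ[k] k, ∀ a, x a = 0 ↔ a ∈ P := by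
  have h1 : ∀ f : k[X], algebraMap k[X] A f - algebraMap k A (f.eval c) ∈ P := by
    intro f
    rw [IsScalarTower.algebraMap_apply k k[X] A, ← map_sub]
    obtain ⟨q, hq⟩ : X - C c ∣ f - C (f.eval c) := X_sub_C_dvd_sub_C_eval
    rw [algebraMap_eq, hq, map_mul]
    exact P.mul_mem_right _ hP
  have h2 : ∀ a : A, ∃ b : k, a - algebraMap k A b ∈ P := by
    have : Algebra.IsIntegral k (A ⧸ P) := by
      constructor
      intro y
      obtain ⟨a, rfl⟩ := Ideal.Quotient.mk_surjective y
      obtain ⟨m, hm, hma⟩ := Algebra.IsIntegral.isIntegral (R := k[X]) a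
      refine ⟨m.map (evalRingHom c), hm.map _, ?_⟩
      rw [eval₂_map]
      have h3 : (algebraMap k (A ⧸ P)).comp (evalRingHom c) =
          (Ideal.Quotient.mk P).comp (algebraMap k[X] A) := by
        refine RingHom.ext fun f => ?_
        change Ideal.Quotient.mk P (algebraMap k A (f.eval c)) = Ideal.Quotient.mk P _
        rw [eq_comm, Ideal.Quotient.eq]
        exact h1 f
      rw [h3, ← hom_eval₂, hma, map_zero]
    intro a
    obtain ⟨b, hb⟩ := (IsAlgClosed.algebraMap_bijective_of_isIntegral (k := k) (K := A ⧸ P)).2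
      (Ideal.Quotient.mk P a)
    refine ⟨b, ?_⟩
    rw [← Ideal.Quotient.eq, ← hb]
    simp
  have h4 : ∀ b : k, algebraMap k A b ∈ P → b = 0 := by
    intro b hb
    by_contra hb0
    apply ‹P.IsPrime›.ne_top
    exact Ideal.eq_top_of_isUnit_mem _ hb ((isUnit_iff_ne_zero.2 hb0).map _)
  choose x hx using h2
  have huniq : ∀ a b, a - algebraMap k A b ∈ P → x a = b := by
    intro a b hb
    have := P.sub_mem hb (hx a)
    rw [sub_sub_sub_cancel_left, ← map_sub] at this
    exact sub_eq_zero.1 (h4 _ this)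
  refine ⟨⟨⟨⟨⟨x, ?_⟩, ?_⟩, ?_, ?_⟩, ?_⟩, ?_⟩
  · apply huniq; simp
  · intro a b
    apply huniq
    have : a * b - algebraMap k A (x a * x b) = (a - algebraMap k A (x a)) * b +
        algebraMap k A (x a) * (b - algebraMap k A (x b)) := by rw [map_mul]; ring
    rw [this]
    exact P.add_mem (P.mul_mem_right _ (hx a)) (P.mul_mem_left _ (hx b))
  · apply huniq; simp
  · intro a b
    apply huniq
    have : a + b - algebraMap k A (x a + x b) = (a - algebraMap k A (x a)) +
        (b - algebraMap k A (x b)) := by rw [map_add]; ring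
    change a + b - algebraMap k A (x a + x b) ∈ P
    rw [this]
    exact P.add_mem (hx a) (hx b)
  · intro r
    apply huniq; simp
  · intro a
    change x a = 0 ↔ _
    constructor
    · intro h
      have := hx a
      rwa [h, map_zero, sub_zero] at this
    · intro h
      apply huniq
      simpa using h

lemma avoid {ι : Type*} {J : Type*} [Finite J] (S : Set A) (hS : Algebra.adjoin k S = ⊤)
    (f : (ι → k) →ₗ[k] A) (hf : ∀ s ∈ S, ∃ t, f t = s)
    (B : J → Subalgebra k A) (hB : ∀ j, B j ≠ ⊤) : ∃ t, ∀ j, f t ∉ B j := by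
  by_contra hcon
  push Not at hcon
  have h1 : ⋃ j, (((Subalgebra.toSubmodule (B j)).comap f : Submodule k (ι → k)) : Set (ι → k))
      = Set.univ := by
    rw [Set.eq_univ_iff_forall]
    intro t
    obtain ⟨j, hj⟩ := hcon t
    exact Set.mem_iUnion.2 ⟨j, hj⟩
  have : Infinite k := IsAlgClosed.instInfinite
  obtain ⟨j, hj⟩ := Subspace.exists_eq_top_of_iUnion_eq_univ h1
  apply hB j
  rw [eq_top_iff, ← hS, Algebra.adjoin_le_iff]
  intro s hs
  obtain ⟨t, rfl⟩ := hf s hs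
  have : t ∈ ((Subalgebra.toSubmodule (B j)).comap f) := by rw [hj]; trivial
  exact this

/-- Functions with vanishing differential at `P`. -/
def tangentSub (x : A →ₐ[k] k) (Q : Ideal A) : Subalgebra k A where
  carrier := {a | a - algebraMap k A (x a) ∈ Q}
  mul_mem' := by
    intro a b ha hb
    have : a * b - algebraMap k A (x (a * b)) = (a - algebraMap k A (x a)) * b +
        algebraMap k A (x a) * (b - algebraMap k A (x b)) := by rw [map_mul, map_mul]; ring
    change _ ∈ Q
    rw [this]
    exact Q.add_mem (Q.mul_mem_right _ ha) (Q.mul_mem_left _ hb)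
  add_mem' := by
    intro a b ha hb
    have : a + b - algebraMap k A (x (a + b)) = (a - algebraMap k A (x a)) +
        (b - algebraMap k A (x b)) := by rw [map_add, map_add]; ring
    change _ ∈ Q
    rw [this]
    exact Q.add_mem ha hb
  algebraMap_mem' := by
    intro r
    change _ ∈ Q
    simp

end Points

end Polynomial.NodalCurve

namespace Polynomial.NodalCurve

section Points2
open Polynomial

lemma le_of_pow_mem {A : Type*} [CommRing A] [IsDedekindDomain A] {P : Ideal A} [P.IsPrime] (hP : P ≠ ⊥) {x : A} (hx2 : x ∉ P ^ 2)
    {m e : ℕ} (h : x ^ m ∈ P ^ e) : e ≤ m := by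
  have hprime := Ideal.prime_of_isPrime hP ‹_›
  rw [← Ideal.dvd_span_singleton, ← Ideal.span_singleton_pow, pow_dvd_iff_le_emultiplicity,
    emultiplicity_pow hprime] at h
  have h2 : emultiplicity P (Ideal.span {x}) < 2 := by
    rw [← Ideal.dvd_span_singleton] at hx2
    exact_mod_cast emultiplicity_lt_iff_not_dvd.2 hx2
  have h3 : emultiplicity P (Ideal.span {x}) ≤ 1 := Order.le_of_lt_add_one (by simpa [one_add_one_eq_two] using h2)
  have h4 : (e : ℕ∞) ≤ m * 1 := h.trans (by gcongr)
  rw [mul_one] at h4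
  exact_mod_cast h4

open Polynomial
variable {k A : Type*} [Field k] [IsAlgClosed k] [CommRing A] [IsDedekindDomain A]
  [Algebra k A] [Algebra k[X] A]
  [IsScalarTower k k[X] A] [Module.Finite k[X] A] [Module.IsTorsionFree k[X] A]

lemma exists_indep (F K : Type*) [Field F] [Field K] [Algebra k[X] F] [IsFractionRing k[X] F]
    [Algebra A K] [IsFractionRing A K] [Algebra F K] [Algebra k[X] K] [IsScalarTower k[X] A K]
    [IsScalarTower k[X] F K] {n : ℕ} (hn : Module.finrank F K = n)
    {ι : Type*} (S : Set A) (hS : Algebra.adjoin k S = ⊤)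
    (f : (ι → k) →ₗ[k] A) (hf : ∀ s ∈ S, ∃ t, f t = s) (c : k) :
    ∃ t, Indep n (f t) c := by
  classical
  set p : Ideal k[X] := Ideal.span {X - C c} with hp
  have hpmax : p.IsMaximal :=
    PrincipalIdealRing.isMaximal_of_irreducible (irreducible_X_sub_C c)
  have hp0 : p ≠ ⊥ := by
    rw [hp, Ne, Ideal.span_singleton_eq_bot]
    exact X_sub_C_ne_zero c
  set T := IsDedekindDomain.primesOverFinset p A with hT
  have hT1 : ∀ P : T, P.1.IsPrime := fun P =>
    ((IsDedekindDomain.mem_primesOverFinset_iff hp0 A).1 P.2).1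
  have hT2 : ∀ P : T, P.1.LiesOver p := fun P =>
    ((IsDedekindDomain.mem_primesOverFinset_iff hp0 A).1 P.2).2
  have hmem : ∀ P : T, algebraMap k[X] A (X - C c) ∈ P.1 := by
    intro P
    have h1 : X - C c ∈ p := Ideal.mem_span_singleton_self _
    rw [(hT2 P).over] at h1
    exact h1
  have hbot : ∀ P : T, P.1 ≠ ⊥ := by
    intro P h
    have := hmem P
    rw [h, Ideal.mem_bot] at this
    have hinj : Function.Injective (algebraMap k[X] A) := FaithfulSMul.algebraMap_injective _ _
    exact X_sub_C_ne_zero c (hinj (by rw [this, map_zero]))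
  have hchar : ∀ P : T, ∃ x : A →ₐ[k] k, ∀ a, x a = 0 ↔ a ∈ P.1 := by
    intro P
    have := hT1 P
    exact exists_char c P.1 (hmem P)
  choose x hx using hchar
  have hsub : ∀ P a, a - algebraMap k A (x P a) ∈ P.1 := by
    intro P a
    rw [← hx]; simp
  obtain ⟨t, ht⟩ := avoid (J := {pq : T × T // pq.1 ≠ pq.2} ⊕ T) S hS f hf
    (fun j => match j with
      | Sum.inl pq => AlgHom.equalizer (x pq.1.1) (x pq.1.2)
      | Sum.inr P => tangentSub (x P) (P.1 ^ 2)) (by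
      rintro (⟨⟨P, Q⟩, hPQ⟩ | P)
      · intro h
        apply hPQ
        apply Subtype.ext
        ext a
        rw [← hx, ← hx]
        have : a ∈ AlgHom.equalizer (x P) (x Q) := by
          change a ∈ (match (Sum.inl ⟨⟨P, Q⟩, hPQ⟩ : {pq : T × T // pq.1 ≠ pq.2} ⊕ T) with
            | Sum.inl pq => AlgHom.equalizer (x pq.1.1) (x pq.1.2)
            | Sum.inr P => tangentSub (x P) (P.1 ^ 2))
          rw [h]; trivial
        rw [AlgHom.mem_equalizer] at this
        rw [this]
      · intro h
        change tangentSub (x P) (P.1 ^ 2) = ⊤ at h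
        have h1 : P.1 ^ 2 < P.1 ^ 1 :=
          Ideal.pow_right_strictAnti P.1 (hbot P) (hT1 P).ne_top (by norm_num)
        rw [pow_one] at h1
        apply h1.not_ge
        intro a ha
        have h2 : a ∈ tangentSub (x P) (P.1 ^ 2) := by rw [h]; trivial
        change a - algebraMap k A (x P a) ∈ P.1 ^ 2 at h2
        rwa [(hx P a).2 ha, map_zero, sub_zero] at h2)
  refine ⟨t, ?_⟩
  set g := f t with hg
  have hsep : ∀ P Q : T, x P g = x Q g → P = Q := by
    intro P Q h
    by_contra hne
    exact ht (Sum.inl ⟨⟨P, Q⟩, hne⟩) h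
  have htan : ∀ P : T, g - algebraMap k A (x P g) ∉ P.1 ^ 2 := fun P => ht (Sum.inr P)
  intro r hr z hz
  by_contra hr0
  have hram : ∀ P : T, Ideal.ramificationIdx' p P.1 ≤ r.rootMultiplicity (x P g) := by
    intro P
    have := hT1 P
    obtain ⟨q, hq, hq'⟩ := exists_eq_pow_rootMultiplicity_mul_and_not_dvd r hr0 (x P g)
    have h1 : aeval g q ∉ P.1 := by
      rw [← hx, ← aeval_algHom_apply, coe_aeval_eq_eval]
      rw [dvd_iff_isRoot] at hq'
      exact hq'
    have h2 : (aeval g q) * (g - algebraMap k A (x P g)) ^ (r.rootMultiplicity (x P g)) ∈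
        P.1 ^ (Ideal.ramificationIdx' p P.1) := by
      have h3 : (aeval g q) * (g - algebraMap k A (x P g)) ^ (r.rootMultiplicity (x P g)) =
          aeval g r := by
        conv_rhs => rw [hq]
        simp [mul_comm]
      rw [h3, hz]
      apply Ideal.mul_mem_right
      apply Ideal.le_pow_ramificationIdx'
      exact Ideal.mem_map_of_mem _ (Ideal.mem_span_singleton_self _)
    rcases Ideal.IsPrime.mul_mem_pow P.1 h2 with h4 | h4
    · exact absurd h4 h1
    · exact le_of_pow_mem (hbot P) (htan P) h4
  have hinert : ∀ P : T, Ideal.inertiaDeg' p P.1 = 1 := by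
    intro P
    have := hT1 P
    have := hT2 P
    have hnt : Nontrivial (A ⧸ P.1) := Ideal.Quotient.nontrivial_iff.2 (hT1 P).ne_top
    let _ : Field (k[X] ⧸ p) := Ideal.Quotient.field p
    rw [Ideal.inertiaDeg'_algebraMap]
    refine finrank_eq_one (1 : A ⧸ P.1) one_ne_zero ?_
    intro w
    obtain ⟨a, rfl⟩ := Ideal.Quotient.mk_surjective w
    refine ⟨Ideal.Quotient.mk p (C (x P a)), ?_⟩
    rw [Algebra.smul_def, mul_one, Ideal.Quotient.algebraMap_mk_of_liesOver, eq_comm, Ideal.Quotient.eq]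
    have := hsub P a
    rwa [IsScalarTower.algebraMap_apply k k[X] A] at this
  have hsum := Ideal.sum_ramification_inertia A F K hp0
  rw [hn, ← Finset.sum_coe_sort] at hsum
  have h5 : n ≤ r.natDegree := by
    calc n = ∑ P : T, Ideal.ramificationIdx' p P.1 * Ideal.inertiaDeg' p P.1 := hsum.symm
      _ ≤ ∑ P : T, r.rootMultiplicity (x P g) := by
        refine Finset.sum_le_sum fun P _ => ?_
        rw [hinert, mul_one]; exact hram P
      _ = ∑ b ∈ Finset.univ.image (fun P : T => x P g), r.roots.count b := by
        rw [Finset.sum_image (fun P _ Q _ h => hsep P Q h)]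
        simp
      _ ≤ ∑ b ∈ Finset.univ.image (fun P : T => x P g) ∪ r.roots.toFinset, r.roots.count b :=
        Finset.sum_le_sum_of_subset Finset.subset_union_left
      _ = Multiset.card r.roots := by
        apply Multiset.sum_count_eq_card
        intro a ha
        exact Finset.mem_union_right _ (Multiset.mem_toFinset.2 ha)
      _ ≤ r.natDegree := card_roots' r
  lia

end Points2

end Polynomial.NodalCurve

namespace Polynomial.NodalCurve

section ResDisc
open Polynomial

lemma resultant_disc {R Ω : Type*} [CommRing R] [Field Ω] (φ : R →+* Ω) {n : ℕ} (p : R[X])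
    (hp : p.Monic) (hn : p.natDegree = n) (x : Fin n → Ω) (hx : Function.Injective x)
    (hroot : ∀ a, (p.map φ).eval (x a) = 0) :
    ∃ ε : Ω, ε ^ 2 = 1 ∧
      φ (p.resultant p.derivative) = ε * (∏ i, ∏ j ∈ Finset.Ioi i, (x j - x i)) ^ 2 := by
  have hprod : p.map φ = ∏ a, (X - C (x a)) := by
    refine eq_of_monic_of_dvd_of_natDegree_le (monic_prod_of_monic _ _ fun i _ => monic_X_sub_C _)
      (hp.map φ) ?_ ?_
    · refine Finset.prod_dvd_of_coprime ?_ ?_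
      · intro i _ j _ hij
        exact pairwise_coprime_X_sub_C hx hij
      · intro i _
        exact dvd_iff_isRoot.2 (hroot i)
    · rw [hp.natDegree_map, natDegree_prod_of_monic _ _ fun i _ => monic_X_sub_C _]
      simp [hn]
  have hroots : (p.map φ).roots = Finset.univ.val.map x := by
    rw [hprod]
    rw [show ∏ a, (X - C (x a)) = ((Finset.univ.val.map x).map fun a => X - C a).prod by
      rw [Multiset.map_map]; rfl]
    exact roots_multiset_prod_X_sub_C _
  have hspl : (p.map φ).Splits := by
    rw [hprod]
    exact Splits.prod fun i _ => Splits.X_sub_C _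
  have h1 : φ (p.resultant p.derivative) = ∏ a, (p.map φ).derivative.eval (x a) := by
    rw [← resultant_map_map, ← derivative_map]
    have := resultant_eq_prod_eval (p.map φ) (p.map φ).derivative p.derivative.natDegree
      (by rw [derivative_map]; exact natDegree_map_le) hspl
    rw [hp.natDegree_map, (hp.map φ).leadingCoeff, one_pow, one_mul, hroots] at this
    rw [this, Multiset.map_map]; rfl
  have h2 : ∀ a, (p.map φ).derivative.eval (x a) = ∏ j ∈ {a}ᶜ, (x a - x j) := by
    intro a
    rw [hprod, derivative_prod_finset, eval_finsetSum, Finset.sum_eq_single a]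
    · simp [eval_prod, Finset.compl_eq_univ_sdiff, Finset.sdiff_singleton_eq_erase]
    · intro b _ hb
      rw [eval_mul, eval_prod, Finset.prod_eq_zero (i := a)]
      · simp
      · simp [hb.symm]
      · simp
    · simp
  refine ⟨∏ i : Fin n, ∏ j ∈ Finset.Ioi i, (-1), ?_, ?_⟩
  · rw [← Finset.prod_pow]
    refine Finset.prod_eq_one fun i _ => ?_
    rw [← Finset.prod_pow]
    refine Finset.prod_eq_one fun i _ => ?_
    simp
  · rw [h1, Finset.prod_congr rfl fun a _ => h2 a,
      ← Finset.prod_prod_Ioi_mul_eq_prod_prod_off_diag (fun j i => x i - x j),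
      ← Finset.prod_pow, ← Finset.prod_mul_distrib]
    refine Finset.prod_congr rfl fun i _ => ?_
    rw [← Finset.prod_pow, ← Finset.prod_mul_distrib]
    refine Finset.prod_congr rfl fun j _ => ?_
    ring

lemma eval_map_evalRingHom {k ι : Type*} [Field k] (I : MvPolynomial ι k[X]) (t : ι → k) (c : k) :
    MvPolynomial.eval t (MvPolynomial.map (evalRingHom c) I) =
      (MvPolynomial.eval (fun i => C (t i)) I).eval c := by
  change _ = evalRingHom c (MvPolynomial.eval (fun i => C (t i)) I)
  rw [MvPolynomial.eval_map, ← MvPolynomial.eval₂_id, MvPolynomial.hom_eval₂]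
  congr 1
  funext i
  simp

end ResDisc
end Polynomial.NodalCurve

namespace Polynomial.NodalCurve

set_option linter.unusedSectionVars false
section Good
open Polynomial

variable {k A : Type*} (F : Type*) {K : Type*} [Field k] [IsAlgClosed k] [CharZero k]
  [Field F] [Field K]
  [CommRing A] [IsDomain A] [Algebra k A] [Algebra k[X] A] [IsScalarTower k k[X] A] [Algebra A K]
  [Algebra k[X] K] [Algebra k K] [IsScalarTower k k[X] K] [IsScalarTower k[X] A K]
  [IsScalarTower k A K]
  [IsIntegralClosure A k[X] K] [Algebra k[X] F] [IsFractionRing k[X] F] [Algebra F K]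
  [IsScalarTower k[X] F K] [FiniteDimensional F K]

lemma charZero_of_frac (k F : Type*) [Field k] [CharZero k] [Field F] [Algebra k[X] F]
    [IsFractionRing k[X] F] : CharZero F :=
  charZero_of_injective_algebraMap (IsFractionRing.injective k[X] F)

lemma torsionFree_K (k F K : Type*) [Field k] [Field F] [Field K] [Algebra k[X] F]
    [IsFractionRing k[X] F] [Algebra F K] [Algebra k[X] K] [IsScalarTower k[X] F K] :
    Function.Injective (algebraMap k[X] K) := by
  rw [IsScalarTower.algebraMap_eq k[X] F K]
  exact (algebraMap F K).injective.comp (IsFractionRing.injective k[X] F)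

lemma exists_basis (n : ℕ) (hn : Module.finrank F K = n) :
    IsDedekindDomain A ∧ Module.Finite k[X] A ∧ Module.IsTorsionFree k[X] A ∧
    IsFractionRing A K ∧ IsLocalization (Algebra.algebraMapSubmonoid A (nonZeroDivisors k[X])) K ∧
    Nonempty (Module.Basis (Fin n) k[X] A) := by
  have := charZero_of_frac k F
  have : Module.IsTorsionFree k[X] K := by
    rw [Module.isTorsionFree_iff_algebraMap_injective]
    exact torsionFree_K k F K
  have h1 := IsIntegralClosure.isDedekindDomain k[X] F K A
  have h2 := IsIntegralClosure.finite k[X] F K A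
  have h3 : Module.IsTorsionFree k[X] A := IsIntegralClosure.isTorsionFree k[X] K
  have h4 := IsIntegralClosure.isFractionRing_of_finite_extension k[X] F K A
  have h5 := IsIntegralClosure.isLocalization k[X] F K A
  have h6 := IsIntegralClosure.module_free k[X] F K A
  have h7 := IsIntegralClosure.rank k[X] F K A
  exact ⟨h1, h2, h3, h4, h5, ⟨Module.finBasisOfFinrankEq k[X] A (h7.trans hn)⟩⟩

lemma eval_idx_C {ι : Type*} [Fintype ι] {n : ℕ} (e : Module.Basis (Fin n) k[X] A) (v : ι → A)
    (t : ι → k) : MvPolynomial.eval (fun i => C (t i)) (idx e v) =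
      (Matrix.of fun i j : Fin n => e.repr ((∑ l, t l • v l) ^ (j : ℕ)) i).det := by
  rw [eval_idx]
  congr! 6 with i j
  congr 1
  refine Finset.sum_congr rfl fun l _ => ?_
  rw [← algebraMap_eq, IsScalarTower.algebraMap_smul]

lemma idx_ne {ι : Type*} [Fintype ι] {n : ℕ} (hn : Module.finrank F K = n)
    (e : Module.Basis (Fin n) k[X] A) (S : Set A) (hS : Algebra.adjoin k S = ⊤) (v : ι → A)
    (hv : ∀ s ∈ S, ∃ l, v l = s) (c : k) :
    MvPolynomial.map (evalRingHom c) (idx e v) ≠ 0 := by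
  classical
  obtain ⟨h1, h2, h3, h4, h5, -⟩ := exists_basis (A := A) (k := k) F (K := K) n hn
  obtain ⟨t, ht⟩ := exists_indep F K hn S hS (Fintype.linearCombination k v) (by
    intro s hs
    obtain ⟨l, hl⟩ := hv s hs
    exact ⟨Pi.single l 1, by simp [hl]⟩) c
  rw [← indep_iff e] at ht
  intro h0
  apply ht
  rw [Fintype.linearCombination_apply, ← eval_idx_C, ← eval_map_evalRingHom, h0, map_zero]

lemma not_sing_of_idx {ι : Type*} [Fintype ι] {n : ℕ} (hn : Module.finrank F K = n)
    (e : Module.Basis (Fin n) k[X] A) (v : ι → A) (t : ι → k) (c : k)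
    (h : (MvPolynomial.eval (fun i => C (t i)) (idx e v)).eval c ≠ 0) (p : k[X][X])
    (hp : p.Monic) (hpn : p.natDegree = n) (h0 : aeval (algebraMap A K (∑ l, t l • v l)) p = 0)
    (b : k) : ¬ Sing p c b := by
  rw [eval_idx_C, indep_iff] at h
  refine not_sing_of_indep p hp c b ?_ _ h0 ?_
  · intro h
    rw [map_eq_zero_iff _ (torsionFree_K k F K)] at h
    exact X_sub_C_ne_zero c h
  · intro r hr z hz hrz
    obtain ⟨z', rfl⟩ := IsIntegralClosure.isIntegral_iff (A := A).1 hz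
    refine h r (hpn ▸ hr) z' ?_
    apply IsIntegralClosure.algebraMap_injective A k[X] K
    rw [map_mul, ← IsScalarTower.algebraMap_apply, ← hrz, aeval_algebraMap_apply]

theorem infGood {ι : Type*} [Fintype ι] {n : ℕ} (hn : Module.finrank F K = n)
    (S : Set A) (hS : Algebra.adjoin k S = ⊤) (v : ι → A)
    (hv : ∀ s ∈ S, ∃ l, v l = s) (c : k) :
    ∃ r : MvPolynomial ι k, r ≠ 0 ∧ ∀ t, MvPolynomial.eval t r ≠ 0 →
      ∀ p : k[X][X], p.Monic → p.natDegree = n → aeval (algebraMap A K (∑ l, t l • v l)) p = 0 →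
        ∀ b, ¬ Sing p c b := by
  obtain ⟨h1, h2, h3, h4, h5, ⟨e⟩⟩ := exists_basis (A := A) (k := k) F (K := K) n hn
  refine ⟨_, idx_ne F hn e S hS v hv c, fun t ht p hp hpn h0 b => ?_⟩
  rw [eval_map_evalRingHom] at ht
  exact not_sing_of_idx F hn e v t c ht p hp hpn h0 b

theorem affGood {ι : Type*} [Fintype ι] {n : ℕ} (hn : Module.finrank F K = n)
    (S : Set A) (h1S : 1 ∈ S) (hS : Algebra.adjoin k S = ⊤) (v : ι → A)
    (hv : ∀ a ∈ S, ∀ b ∈ S, ∀ c ∈ S, ∃ l, v l = a * b * c) :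
    ∃ r : MvPolynomial ι k, r ≠ 0 ∧ ∀ t, MvPolynomial.eval t r ≠ 0 →
      (∀ p : k[X][X], p.natDegree < n → aeval (algebraMap A K (∑ l, t l • v l)) p = 0 → p = 0) ∧
      ∀ p : k[X][X], p.Monic → p.natDegree = n → aeval (algebraMap A K (∑ l, t l • v l)) p = 0 →
        ∀ c b, Sing p c b → ¬ DegHess p c b := by
  classical
  obtain ⟨h1, h2, h3, h4, h5, ⟨e⟩⟩ := exists_basis (A := A) (k := k) F (K := K) n hn
  have := charZero_of_frac k F
  have hv' : ∀ s ∈ S, ∃ l, v l = s := by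
    intro s hs
    obtain ⟨l, hl⟩ := hv s hs 1 h1S 1 h1S
    exact ⟨l, by simpa using hl⟩
  let Ω := AlgebraicClosure F
  let φ : k[X] →+* Ω := (algebraMap F Ω).comp (algebraMap k[X] F)
  have hφ : Function.Injective φ :=
    (algebraMap F Ω).injective.comp (IsFractionRing.injective k[X] F)
  have hcard : Fintype.card (K →ₐ[F] Ω) = n := by rw [AlgHom.card, hn]
  let eq : Fin n ≃ (K →ₐ[F] Ω) := (Fintype.equivFinOfCardEq hcard).symm
  let σ : Fin n → (A →+* Ω) := fun a => (eq a).toRingHom.comp (algebraMap A K)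
  have hσφ : ∀ a r, σ a (algebraMap k[X] A r) = φ r := by
    intro a r
    change eq a (algebraMap A K (algebraMap k[X] A r)) = algebraMap F Ω (algebraMap k[X] F r)
    rw [← IsScalarTower.algebraMap_apply, IsScalarTower.algebraMap_apply k[X] F K,
      AlgHom.commutes]
  have hσS : ∀ i j, i ≠ j → ∃ a ∈ S, σ i a ≠ σ j a := by
    intro i j hij
    by_contra! hcon
    apply hij
    apply eq.injective
    have hA : ∀ a, σ i a = σ j a := by
      intro a
      have ha : a ∈ Algebra.adjoin k S := hS ▸ Algebra.mem_top
      induction ha using Algebra.adjoin_induction with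
      | mem x hx => exact hcon x hx
      | algebraMap r => rw [IsScalarTower.algebraMap_apply k k[X] A, hσφ, hσφ]
      | add x y _ _ hx hy => rw [map_add, map_add, hx, hy]
      | mul x y _ _ hx hy => rw [map_mul, map_mul, hx, hy]
    refine AlgHom.ext fun z => ?_
    obtain ⟨a, b, -, rfl⟩ := IsFractionRing.div_surjective A z
    rw [map_div₀, map_div₀]
    exact congrArg₂ _ (hA a) (hA b)
  have hsq := squarefree_prod_forms S h1S v hv σ hσS
  have hmap := map_idx φ σ hσφ e v
  rw [← hmap] at hsq
  have hsqI : Squarefree (MvPolynomial.map φ (idx e v)) :=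
    hsq.squarefree_of_dvd (dvd_mul_left _ _)
  have hdet : (Matrix.of fun a i => σ a (e i)).det ≠ 0 := by
    intro h0
    rw [h0, map_zero, zero_mul] at hsq
    exact not_squarefree_zero hsq
  have hD : φ (Algebra.discr k[X] e) = (Matrix.of fun a i => σ a (e i)).det ^ 2 := by
    change algebraMap F Ω _ = _
    rw [← Algebra.discr_localizationLocalization k[X] (nonZeroDivisors k[X]) K e,
      Algebra.discr_eq_det_embeddingsMatrixReindex_pow_two F Ω _ eq, ← Matrix.det_transpose]
    congr 2
    ext i j
    simp [Algebra.embeddingsMatrixReindex, σ]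
  have hD0 : Algebra.discr k[X] e ≠ 0 := by
    intro h0
    rw [h0, map_zero] at hD
    exact pow_ne_zero 2 hdet hD.symm
  have hIc := idx_ne F hn e S hS v hv'
  obtain ⟨r, hr0, hr⟩ := bertini φ hφ (idx e v) hIc hsqI _ hD0
  refine ⟨r * MvPolynomial.map (evalRingHom 0) (idx e v), mul_ne_zero hr0 (hIc 0),
    fun t ht => ?_⟩
  rw [map_mul] at ht
  have hr' := hr t (left_ne_zero_of_mul ht)
  have ht0 := right_ne_zero_of_mul ht
  rw [eval_map_evalRingHom] at ht0
  set I := MvPolynomial.eval (fun i => C (t i)) (idx e v) with hI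
  have hI0 : I ≠ 0 := by
    intro h
    rw [h] at ht0
    simp at ht0
  set g := ∑ l, t l • v l with hg
  -- evaluate the index formula
  have hvand : (Matrix.of fun a i => σ a (e i)).det * φ I =
      ∏ i, ∏ j ∈ Finset.Ioi i, (σ j g - σ i g) := by
    have h := congrArg (MvPolynomial.eval (fun i => φ (C (t i)))) hmap
    have hs : ∀ a, σ a g = ∑ l, σ a (v l) * φ (C (t l)) := by
      intro a
      rw [hg, map_sum]
      refine Finset.sum_congr rfl fun l _ => ?_
      rw [Algebra.smul_def, map_mul, IsScalarTower.algebraMap_apply k k[X] A, hσφ, mul_comm]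
      rfl
    rw [map_mul, MvPolynomial.eval_C, map_prod] at h
    simp only [map_prod, map_sub, map_sum, map_mul, MvPolynomial.eval_C, MvPolynomial.eval_X] at h
    simp only [hs]
    rw [← h, MvPolynomial.eval_map, hI, ← MvPolynomial.eval₂_id, MvPolynomial.hom_eval₂]
    rfl
  have hinj : Function.Injective (fun a => σ a g) := by
    intro i j hij
    by_contra hne
    have h0 : ∏ i, ∏ j ∈ Finset.Ioi i, (σ j g - σ i g) ≠ 0 := by
      rw [← hvand]
      exact mul_ne_zero hdet ((map_ne_zero_iff _ hφ).2 hI0)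
    rw [Finset.prod_ne_zero_iff] at h0
    have hij' : σ i g = σ j g := hij
    rcases lt_or_gt_of_ne hne with h | h
    · exact Finset.prod_ne_zero_iff.1 (h0 i (Finset.mem_univ _)) j (Finset.mem_Ioi.2 h)
        (by rw [hij', sub_self])
    · exact Finset.prod_ne_zero_iff.1 (h0 j (Finset.mem_univ _)) i (Finset.mem_Ioi.2 h)
        (by rw [hij', sub_self])
  have hroot : ∀ p : k[X][X], aeval (algebraMap A K g) p = 0 → ∀ a, (p.map φ).eval (σ a g) = 0 := by
    intro p hp a
    have := congrArg (eq a) hp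
    rw [map_zero, aeval_def, ← AlgHom.coe_toRingHom, hom_eval₂] at this
    rw [eval_map, ← this]
    congr 1
    refine RingHom.ext fun r => ?_
    have := (hσφ a r).symm
    rw [this]
    simp [σ, ← IsScalarTower.algebraMap_apply]
  refine ⟨?_, ?_⟩
  · intro p hpn hp0
    by_contra hpne
    have hne : p.map φ ≠ 0 := (Polynomial.map_ne_zero_iff hφ).2 hpne
    have h1 : (Finset.univ.image fun a => σ a g).card ≤ (p.map φ).natDegree := by
      apply card_le_degree_of_subset_roots
      intro x hx
      simp only [Finset.mem_val, Finset.mem_image, Finset.mem_univ, true_and] at hx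
      obtain ⟨a, rfl⟩ := hx
      exact (mem_roots hne).2 (hroot p hp0 a)
    rw [Finset.card_image_of_injective _ hinj] at h1
    have h2 : (p.map φ).natDegree ≤ p.natDegree := natDegree_map_le
    simp at h1
    lia
  · intro p hp hpn hp0 c b hs hd
    by_cases hIc0 : I.eval c = 0
    · obtain ⟨hDc, hI'⟩ := hr' c hIc0
      obtain ⟨ε, hε, hres⟩ := resultant_disc φ p hp hpn _ hinj (hroot p hp0)
      rw [← hvand, mul_pow, ← hD] at hres
      have hres2 : p.resultant p.derivative = Algebra.discr k[X] e * I ^ 2 ∨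
          p.resultant p.derivative = -(Algebra.discr k[X] e * I ^ 2) := by
        rcases sq_eq_sq_iff_eq_or_eq_neg.1 (hε.trans (one_pow 2).symm) with h | h
        · left; apply hφ; rw [hres, h]; simp
        · right; apply hφ; rw [hres, h, map_neg, map_mul, map_pow]; exact neg_one_mul _
      have hdvd : (X - C c) ^ 3 ∣ Algebra.discr k[X] e * I ^ 2 := by
        have := cube_dvd_of_degHess p hp c b hs hd
        rcases hres2 with h | h
        · rwa [h] at this
        · rwa [h, dvd_neg] at this
      obtain ⟨J, hJ⟩ : X - C c ∣ I := dvd_iff_isRoot.2 hIc0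
      have hJc : J.eval c ≠ 0 := by
        intro h0
        apply hI'
        rw [hJ]
        simp [derivative_mul, h0]
      have h2 : (X - C c) ∣ Algebra.discr k[X] e * J ^ 2 := by
        have hx : (X - C c) ^ 2 ≠ 0 := pow_ne_zero 2 (X_sub_C_ne_zero c)
        rw [hJ] at hdvd
        refine (mul_dvd_mul_iff_left hx).1 ?_
        convert hdvd using 1 <;> ring
      rw [dvd_iff_isRoot, IsRoot, eval_mul, eval_pow] at h2
      exact mul_ne_zero hDc (pow_ne_zero 2 hJc) h2
    · exact not_sing_of_idx F hn e v t c hIc0 p hp hpn hp0 b hs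

end Good
end Polynomial.NodalCurve

namespace Polynomial.NodalCurve

set_option linter.unusedSectionVars false
set_option linter.style.haveILetI false
section Good2
open Polynomial

variable {k A : Type*} (F : Type*) {K : Type*} [Field k] [IsAlgClosed k] [CharZero k]
  [Field F] [Field K]
  [CommRing A] [IsDomain A] [Algebra k A] [Algebra k[X] A] [IsScalarTower k k[X] A] [Algebra A K]
  [Algebra k[X] K] [Algebra k K] [IsScalarTower k k[X] K] [IsScalarTower k[X] A K]
  [IsScalarTower k A K]
  [IsIntegralClosure A k[X] K] [Algebra k[X] F] [IsFractionRing k[X] F] [Algebra F K]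
  [IsScalarTower k[X] F K] [FiniteDimensional F K]

lemma exists_monic {n : ℕ} (hn : Module.finrank F K = n) (g : A) :
    ∃ p : k[X][X], p.Monic ∧ p.natDegree = n ∧ aeval (algebraMap A K g) p = 0 := by
  obtain ⟨h1, h2, h3, h4, h5, ⟨e⟩⟩ := exists_basis (A := A) (k := k) F (K := K) n hn
  have := Module.Free.of_basis e
  refine ⟨(Algebra.lmul k[X] A g).charpoly, LinearMap.charpoly_monic _, ?_, ?_⟩
  · rw [LinearMap.charpoly_natDegree, Module.finrank_eq_card_basis e, Fintype.card_fin]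
  · rw [aeval_algebraMap_apply]
    have h := LinearMap.aeval_self_charpoly (Algebra.lmul k[X] A g)
    rw [aeval_algHom_apply] at h
    have h' := congrArg (fun f : Module.End k[X] A => f 1) h
    have h'' : aeval g (Algebra.lmul k[X] A g).charpoly = 0 := by simpa using h'
    rw [h'', map_zero]

lemma finiteType_A {n : ℕ} (hn : Module.finrank F K = n) : Algebra.FiniteType k A := by
  obtain ⟨h1, h2, h3, h4, h5, ⟨e⟩⟩ := exists_basis (A := A) (k := k) F (K := K) n hn
  exact Algebra.FiniteType.trans (S := k[X]) inferInstance inferInstance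

lemma span_pow_top {n : ℕ} (hn : Module.finrank F K = n) (g : K)
    (hind : ∀ p : k[X][X], p.natDegree < n → aeval g p = 0 → p = 0) :
    Submodule.span F (Set.range fun i : Fin n => g ^ (i : ℕ)) = ⊤ := by
  have hpos : 0 < n := hn ▸ Module.finrank_pos
  have : Nonempty (Fin n) := ⟨⟨0, hpos⟩⟩
  apply LinearIndependent.span_eq_top_of_card_eq_finrank
  · rw [← LinearIndependent.iff_fractionRing k[X] F, Fintype.linearIndependent_iff]
    intro c hc
    have hdeg : (∑ i : Fin n, C (c i) * X ^ (i : ℕ)).natDegree < n := by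
      have h5 : (∑ i : Fin n, C (c i) * X ^ (i : ℕ)).natDegree ≤ n - 1 := by
        apply natDegree_sum_le_of_forall_le
        intro j _
        refine (natDegree_C_mul_X_pow_le _ _).trans ?_
        have := j.2
        lia
      lia
    have h0 := hind (∑ i : Fin n, C (c i) * X ^ (i : ℕ)) hdeg (by
      rw [← hc, map_sum]
      refine Finset.sum_congr rfl fun i _ => ?_
      rw [map_mul, aeval_C, map_pow, aeval_X, Algebra.smul_def])
    intro j
    have := congrArg (fun q => coeff q (j : ℕ)) h0
    simpa [finsetSum_coeff, coeff_C_mul, coeff_X_pow, ← Fin.ext_iff] using this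
  · rw [Fintype.card_fin, hn]

end Good2

section NoInst
open Polynomial IntermediateField

variable {k K : Type*} [Field k] [Field K] [Algebra k K]

/-- Evaluation of a bivariate polynomial at `(w, g)`. -/
noncomputable def ev (w g : K) : k[X][X] →+* K :=
  eval₂RingHom (aeval w : k[X] →ₐ[k] K).toRingHom g

/-- Integrality over `k[w]`. -/
def IntEl (k : Type*) {K : Type*} [Field k] [Field K] [Algebra k K] (w z : K) : Prop :=
  (aeval w : k[X] →ₐ[k] K).toRingHom.IsIntegralElem z

variable [IsAlgClosed k] [CharZero k]

lemma isFractionRing_adjoin (w : K) (htr : Transcendental k w) :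
    letI : Algebra k[X] k⟮w⟯ := (aeval (AdjoinSimple.gen k w) : k[X] →ₐ[k] k⟮w⟯).toAlgebra
    IsFractionRing k[X] k⟮w⟯ := by
  letI : Algebra k[X] k⟮w⟯ := (aeval (AdjoinSimple.gen k w) : k[X] →ₐ[k] k⟮w⟯).toAlgebra
  have hco : ∀ r : k[X], ((algebraMap k[X] k⟮w⟯ r : k⟮w⟯) : K) = aeval w r := by
    intro r
    change algebraMap k⟮w⟯ K (aeval (AdjoinSimple.gen k w) r) = _
    rw [← aeval_algebraMap_apply, AdjoinSimple.algebraMap_gen]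
  have : FaithfulSMul k[X] k⟮w⟯ := by
    rw [faithfulSMul_iff_algebraMap_injective, injective_iff_map_eq_zero]
    intro r hr
    have := hco r
    rw [hr] at this
    exact (transcendental_iff.1 htr) r (by simpa using this.symm)
  refine IsFractionRing.of_field _ _ ?_
  intro z
  obtain ⟨r, s, hrs⟩ := (mem_adjoin_simple_iff k (z : K)).1 z.2
  refine ⟨r, s, ?_⟩
  apply Subtype.ext
  rw [hrs, ← hco, ← hco]
  rfl

/-- All the instances needed for the structure `X ↦ w`. -/
theorem noInst_package (A : Subalgebra k K) (w : K) (htr : Transcendental k w)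
    (hA : ∀ z, z ∈ A ↔ IntEl k w z) [FiniteDimensional k⟮w⟯ K] {n : ℕ}
    (hn : Module.finrank k⟮w⟯ K = n) :
    (∀ {ι : Type} [Fintype ι] (S : Set A) (_ : Algebra.adjoin k S = ⊤) (v : ι → A)
      (_ : ∀ s ∈ S, ∃ l, v l = s) (c : k),
      ∃ r : MvPolynomial ι k, r ≠ 0 ∧ ∀ t, MvPolynomial.eval t r ≠ 0 →
      ∀ p : k[X][X], p.Monic → p.natDegree = n → ev w ((∑ l, t l • v l : A) : K) p = 0 →
        ∀ b, ¬ Sing p c b) ∧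
    (∀ {ι : Type} [Fintype ι] (S : Set A) (_ : 1 ∈ S) (_ : Algebra.adjoin k S = ⊤) (v : ι → A)
      (_ : ∀ a ∈ S, ∀ b ∈ S, ∀ c ∈ S, ∃ l, v l = a * b * c),
      ∃ r : MvPolynomial ι k, r ≠ 0 ∧ ∀ t, MvPolynomial.eval t r ≠ 0 →
      (∀ p : k[X][X], p.natDegree < n → ev w ((∑ l, t l • v l : A) : K) p = 0 → p = 0) ∧
      ∀ p : k[X][X], p.Monic → p.natDegree = n → ev w ((∑ l, t l • v l : A) : K) p = 0 →
        ∀ c b, Sing p c b → ¬ DegHess p c b) ∧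
    (∀ g : A, ∃ p : k[X][X], p.Monic ∧ p.natDegree = n ∧ ev w (g : K) p = 0) ∧
    Algebra.FiniteType k A ∧
    (∀ g : K, (∀ p : k[X][X], p.natDegree < n → ev w g p = 0 → p = 0) →
      Submodule.span k⟮w⟯ (Set.range fun i : Fin n => g ^ (i : ℕ)) = ⊤) := by
  have hwA : w ∈ A := by
    rw [hA]
    have : w = (aeval w : k[X] →ₐ[k] K).toRingHom X := by simp
    unfold IntEl
    nth_rewrite 2 [this]
    exact RingHom.isIntegralElem_map _
  letI a1 : Algebra k[X] k⟮w⟯ := (aeval (AdjoinSimple.gen k w) : k[X] →ₐ[k] k⟮w⟯).toAlgebra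
  haveI a2 : IsFractionRing k[X] k⟮w⟯ := isFractionRing_adjoin w htr
  letI a3 : Algebra k[X] K := (aeval w : k[X] →ₐ[k] K).toAlgebra
  letI a4 : Algebra k[X] A := (aeval (⟨w, hwA⟩ : A) : k[X] →ₐ[k] A).toAlgebra
  haveI : IsScalarTower k k[X] A := IsScalarTower.of_algebraMap_eq fun r => by
    change _ = aeval (⟨w, hwA⟩ : A) (C r)
    rw [aeval_C]
  haveI : IsScalarTower k k[X] K := IsScalarTower.of_algebraMap_eq fun r => by
    change _ = aeval w (C r)
    rw [aeval_C]
  haveI : IsScalarTower k[X] A K := IsScalarTower.of_algebraMap_eq fun r => by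
    change aeval w r = algebraMap A K (aeval (⟨w, hwA⟩ : A) r)
    rw [← aeval_algebraMap_apply]; rfl
  haveI : IsScalarTower k[X] k⟮w⟯ K := IsScalarTower.of_algebraMap_eq fun r => by
    change aeval w r = algebraMap k⟮w⟯ K (aeval (AdjoinSimple.gen k w) r)
    rw [← aeval_algebraMap_apply, AdjoinSimple.algebraMap_gen]
  haveI : IsIntegralClosure A k[X] K := ⟨Subtype.val_injective, by
    intro x
    change IntEl k w x ↔ _
    rw [← hA]
    exact ⟨fun h => ⟨⟨x, h⟩, rfl⟩, fun ⟨y, hy⟩ => hy ▸ y.2⟩⟩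
  refine ⟨?_, ?_, ?_, ?_, ?_⟩
  · intro ι _ S hS v hv c
    exact infGood k⟮w⟯ hn S hS v hv c
  · intro ι _ S h1 hS v hv
    exact affGood k⟮w⟯ hn S h1 hS v hv
  · exact exists_monic k⟮w⟯ hn
  · exact finiteType_A k⟮w⟯ hn
  · exact span_pow_top k⟮w⟯ hn

end NoInst
end Polynomial.NodalCurve

namespace Polynomial.NodalCurve

set_option linter.unusedSectionVars false
set_option linter.style.haveILetI false
section Model
open Polynomial IntermediateField

variable {k K : Type*} [Field k] [Field K] [Algebra k K]

/-- The integral closure of `k[w]` in `K`, as a `k`-subalgebra. -/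
noncomputable def icl (k : Type*) {K : Type*} [Field k] [Field K] [Algebra k K] (w : K) :
    Subalgebra k K :=
  letI a3 : Algebra k[X] K := (aeval w : k[X] →ₐ[k] K).toAlgebra
  haveI : IsScalarTower k k[X] K := IsScalarTower.of_algebraMap_eq fun r => by
    change _ = aeval w (C r)
    rw [aeval_C]
  (integralClosure k[X] K).restrictScalars k

lemma mem_icl (w z : K) : z ∈ icl k w ↔ IntEl k w z := Iff.rfl

lemma intEl_of_coeffs (w : K) (q : K[X]) (hq : q.Monic) (hc : ∀ i, IntEl k w (q.coeff i)) (z : K)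
    (hz : q.eval z = 0) : IntEl k w z := by
  letI a3 : Algebra k[X] K := (aeval w : k[X] →ₐ[k] K).toAlgebra
  have hl : q ∈ lifts (algebraMap (integralClosure k[X] K) K) := by
    rw [lifts_iff_coeff_lifts]
    intro i
    exact ⟨⟨q.coeff i, hc i⟩, rfl⟩
  obtain ⟨q', h1, -, h2⟩ := lifts_and_natDegree_eq_and_monic hl hq
  have : IsIntegral (integralClosure k[X] K) z := ⟨q', h2, by rw [← eval_map, h1, hz]⟩
  exact isIntegral_trans (R := k[X]) z this

lemma intEl_aeval (w : K) (r : k[X]) : IntEl k w (aeval w r) :=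
  RingHom.isIntegralElem_map (aeval w : k[X] →ₐ[k] K).toRingHom

lemma intEl_self (w : K) : IntEl k w w := by
  have := intEl_aeval w (X : k[X])
  rwa [aeval_X] at this

lemma intEl_aeval_of (w u : K) (h : IntEl k w u) (r : k[X]) : IntEl k w (aeval u r) := by
  rw [← mem_icl] at h ⊢
  have := (aeval (⟨u, h⟩ : icl k w) r).2
  have h2 : ((aeval (⟨u, h⟩ : icl k w) r : icl k w) : K) = aeval u r := by
    change (icl k w).val _ = _
    rw [← aeval_algHom_apply]; rfl
  rwa [h2] at this

lemma intEl_trans (w u z : K) (h : IntEl k w u) (hz : IntEl k u z) : IntEl k w z := by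
  obtain ⟨q, hq, hqz⟩ := hz
  refine intEl_of_coeffs w (q.map (aeval u : k[X] →ₐ[k] K).toRingHom) (hq.map _) ?_ z
    (by rw [eval_map, hqz])
  intro i
  rw [coeff_map]
  exact intEl_aeval_of w u h _

lemma intEl_pow_iff (u z : K) {d : ℕ} (hd : 0 < d) : IntEl k (u ^ d) z ↔ IntEl k u z := by
  constructor
  · intro h
    refine intEl_trans _ _ _ ?_ h
    have := intEl_aeval u (X ^ d : k[X])
    rwa [map_pow, aeval_X] at this
  · intro h
    refine intEl_trans _ _ _ ?_ h
    refine intEl_of_coeffs _ (X ^ d - C (u ^ d)) (monic_X_pow_sub_C _ hd.ne') ?_ _ (by simp)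
    intro i
    rw [coeff_sub, coeff_X_pow, coeff_C]
    refine (icl k (u ^ d)).sub_mem ?_ ?_
    · split_ifs
      · exact one_mem _
      · exact zero_mem _
    · split_ifs
      · exact intEl_self _
      · exact zero_mem _

lemma intEl_inv_pow (u z : K) (hu : u ≠ 0) (hz : IntEl k u z) :
    ∃ d0, ∀ d, d0 ≤ d → IntEl k u⁻¹ (z * u⁻¹ ^ d) := by
  obtain ⟨q, hq, hqz⟩ := hz
  refine ⟨q.support.sup fun i => (q.coeff i).natDegree, fun d hd => ?_⟩
  set f := (aeval u : k[X] →ₐ[k] K).toRingHom with hf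
  refine intEl_of_coeffs _ ((q.map f).scaleRoots (u⁻¹ ^ d))
    ((monic_scaleRoots_iff _).2 (hq.map _)) ?_ _ ?_
  · intro i
    rw [coeff_scaleRoots, hq.natDegree_map, coeff_map]
    by_cases hi : q.natDegree ≤ i
    · rw [Nat.sub_eq_zero_of_le hi, pow_zero, mul_one]
      rcases hi.eq_or_lt with h | h
      · rw [← h, hq.coeff_natDegree, map_one]
        exact one_mem (icl k u⁻¹)
      · rw [coeff_eq_zero_of_natDegree_lt h, map_zero]
        exact zero_mem (icl k u⁻¹)
    · have hN : (q.coeff i).natDegree ≤ d * (q.natDegree - i) := by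
        have h1 : (q.coeff i).natDegree ≤ d := by
          by_cases h0 : q.coeff i = 0
          · simp [h0]
          · exact (Finset.le_sup (f := fun i => (q.coeff i).natDegree) (mem_support_iff.2 h0)).trans hd
        refine h1.trans (Nat.le_mul_of_pos_right d (by lia))
      letI := invertibleOfNonzero hu
      have := eval₂_reflect_mul_pow (algebraMap k K) u _ _ hN
      have h3 : f (q.coeff i) = aeval u⁻¹ (reflect (d * (q.natDegree - i)) (q.coeff i)) *
          u ^ (d * (q.natDegree - i)) := by
        rw [aeval_def, ← invOf_eq_inv u, this]; rfl
      rw [h3, ← pow_mul, mul_assoc, ← mul_pow, mul_inv_cancel₀ hu, one_pow, mul_one]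
      exact intEl_aeval _ _
  · have h0 : (q.map f).eval₂ (RingHom.id K) z = 0 := by
      rw [eval₂_id, eval_map]; exact hqz
    have := scaleRoots_eval₂_eq_zero (RingHom.id K) (s := u⁻¹ ^ d) h0
    rwa [eval₂_id, RingHom.id_apply, mul_comm] at this

lemma finDim_pow (u : K) [FiniteDimensional k⟮u⟯ K] {d : ℕ} (hd : 0 < d) :
    FiniteDimensional k⟮u ^ d⟯ K := by
  have hle : k⟮u ^ d⟯ ≤ k⟮u⟯ := by
    rw [adjoin_simple_le_iff]
    exact pow_mem (mem_adjoin_simple_self k u) d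
  have hIntegral : IsIntegral k⟮u ^ d⟯ u := by
    refine ⟨X ^ d - C (AdjoinSimple.gen k (u ^ d)), monic_X_pow_sub_C _ hd.ne', ?_⟩
    simp
  have h1 : FiniteDimensional k⟮u ^ d⟯ (extendScalars hle) := by
    rw [extendScalars_adjoin hle]
    exact adjoin.finiteDimensional hIntegral
  have h2 : FiniteDimensional (extendScalars hle) K := inferInstanceAs (FiniteDimensional k⟮u⟯ K)
  exact Module.Finite.trans (extendScalars hle) K

lemma adjoin_inv (w : K) : k⟮w⁻¹⟯ = k⟮w⟯ := by
  apply le_antisymm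
  · rw [adjoin_simple_le_iff]
    exact inv_mem (mem_adjoin_simple_self k w)
  · rw [adjoin_simple_le_iff]
    have := inv_mem (mem_adjoin_simple_self k w⁻¹)
    rwa [inv_inv] at this

lemma exists_bound {α : Type*} (s : Finset α) (P : α → ℕ → Prop)
    (h : ∀ a ∈ s, ∃ d0, ∀ d, d0 ≤ d → P a d) : ∃ d0, ∀ d, d0 ≤ d → ∀ a ∈ s, P a d := by
  choose! f hf using h
  exact ⟨s.sup f, fun d hd a ha => hf a ha d ((Finset.le_sup ha).trans hd)⟩

lemma exists_gens (A : Subalgebra k K) (h : Algebra.FiniteType k A) :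
    ∃ S : Finset A, 1 ∈ S ∧ Algebra.adjoin k (S : Set A) = ⊤ := by
  classical
  obtain ⟨S, hS⟩ := h
  refine ⟨insert 1 S, Finset.mem_insert_self _ _, ?_⟩
  rw [eq_top_iff, ← hS]
  exact Algebra.adjoin_mono (by simp)

theorem exists_model {k K : Type} [Field k] [Field K] [Algebra k K] [IsAlgClosed k] [CharZero k]
    (u : K) (htr : Transcendental k u) [FiniteDimensional k⟮u⟯ K] :
    ∃ (n : ℕ) (w g : K), 0 < n ∧ w ≠ 0 ∧ adjoin k {w, g} = ⊤ ∧
      (∀ p : k[X][X], p.natDegree < n → ev w g p = 0 → p = 0) ∧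
      (∃ p : k[X][X], p.Monic ∧ p.natDegree = n ∧ ev w g p = 0) ∧
      (∃ p : k[X][X], p.Monic ∧ p.natDegree = n ∧ ev w⁻¹ (g * w⁻¹) p = 0) ∧
      (∀ p : k[X][X], p.Monic → p.natDegree = n → ev w g p = 0 →
        ∀ c b, Sing p c b → ¬ DegHess p c b) ∧
      (∀ p : k[X][X], p.Monic → p.natDegree = n → ev w⁻¹ (g * w⁻¹) p = 0 → ∀ b, ¬ Sing p 0 b) := by
  classical
  have hu : u ≠ 0 := by
    rintro rfl
    exact htr (isAlgebraic_zero)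
  have htr' : ∀ {x : K}, Transcendental k x → Transcendental k x⁻¹ := by
    intro x hx h
    exact hx (by simpa using h.inv)
  have hfinv : ∀ x : K, FiniteDimensional k⟮x⟯ K → FiniteDimensional k⟮x⁻¹⟯ K := by
    intro x hx
    rwa [adjoin_inv]
  have := hfinv u inferInstance
  obtain ⟨-, -, -, ftA, -⟩ := noInst_package (icl k u) u htr (fun z => mem_icl u z) rfl
  obtain ⟨-, -, -, ftB, -⟩ := noInst_package (icl k u⁻¹) u⁻¹ (htr' htr) (fun z => mem_icl _ z) rfl
  obtain ⟨S, h1S, hS⟩ := exists_gens _ ftA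
  obtain ⟨S', -, hS'⟩ := exists_gens _ ftB
  obtain ⟨d1, hd1⟩ := exists_bound (S ×ˢ S ×ˢ S)
    (fun x d => IntEl k u⁻¹ (((x.1 * x.2.1 * x.2.2 : icl k u) : K) * u⁻¹ ^ d))
    (fun x _ => intEl_inv_pow u _ hu ((mem_icl _ _).1 (x.1 * x.2.1 * x.2.2).2))
  obtain ⟨d2, hd2⟩ := exists_bound S' (fun x d => IntEl k u ((x : K) * u ^ d))
    (fun x _ => by
      have := intEl_inv_pow (k := k) u⁻¹ x (inv_ne_zero hu) ((mem_icl _ _).1 x.2)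
      rwa [inv_inv] at this)
  obtain ⟨d, hd, hdd1, hdd2⟩ : ∃ d, 0 < d ∧ d1 ≤ d ∧ d2 ≤ d := ⟨d1 + d2 + 1, by lia, by lia, by lia⟩
  set w := u ^ d with hw
  have hw0 : w ≠ 0 := pow_ne_zero _ hu
  have hwinv : w⁻¹ = u⁻¹ ^ d := by rw [hw, inv_pow]
  have hwtr : Transcendental k w := htr.pow hd
  have hwfin : FiniteDimensional k⟮w⟯ K := finDim_pow u hd
  have hwfin' := hfinv w hwfin
  have hfr : Module.finrank k⟮w⁻¹⟯ K = Module.finrank k⟮w⟯ K := by rw [adjoin_inv]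
  obtain ⟨-, hAff, hmonA, -, hspan⟩ := noInst_package (icl k u) w hwtr
    (fun z => by rw [mem_icl, hw, intEl_pow_iff u z hd]) rfl
  obtain ⟨hInf, -, hmonB, -, -⟩ := noInst_package (icl k u⁻¹) w⁻¹ (htr' hwtr)
    (fun z => by rw [mem_icl, hwinv, intEl_pow_iff _ z hd]) hfr
  let ι := (S × S × S) ⊕ S'
  let v : ι → icl k u := Sum.elim (fun x => x.1 * x.2.1 * x.2.2)
    (fun s => ⟨s * w, hd2 d hdd2 s s.2⟩)
  have hv'mem : ∀ l : ι, (v l : K) * w⁻¹ ∈ icl k u⁻¹ := by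
    rintro (⟨a, b, c⟩ | s)
    · rw [hwinv]
      exact hd1 d hdd1 (a, b, c) (by simp)
    · change (s : K) * w * w⁻¹ ∈ _
      rw [mul_assoc, mul_inv_cancel₀ hw0, mul_one]
      exact (s : icl k u⁻¹).2
  let v' : ι → icl k u⁻¹ := fun l => ⟨_, hv'mem l⟩
  obtain ⟨r, hr0, hr⟩ := hAff (ι := ι) (S : Set (icl k u)) h1S hS v (by
    intro a ha b hb c hc
    exact ⟨Sum.inl (⟨a, ha⟩, ⟨b, hb⟩, ⟨c, hc⟩), rfl⟩)
  obtain ⟨r', hr'0, hr'⟩ := hInf (ι := ι) (S' : Set (icl k u⁻¹)) hS' v' (by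
    intro s hs
    refine ⟨Sum.inr ⟨s, hs⟩, Subtype.ext ?_⟩
    change (s : K) * w * w⁻¹ = _
    rw [mul_assoc, mul_inv_cancel₀ hw0, mul_one]) 0
  obtain ⟨t, ht⟩ : ∃ t, MvPolynomial.eval t (r * r') ≠ 0 := by
    by_contra! hcon
    exact mul_ne_zero hr0 hr'0 (MvPolynomial.funext fun t => by rw [hcon t, map_zero])
  rw [map_mul] at ht
  obtain ⟨hA1, hA2⟩ := hr t (left_ne_zero_of_mul ht)
  have hB := hr' t (right_ne_zero_of_mul ht)
  have hgg : ((∑ l, t l • v' l : icl k u⁻¹) : K) = ((∑ l, t l • v l : icl k u) : K) * w⁻¹ := by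
    simp [Finset.sum_mul, v']
  rw [hgg] at hB
  refine ⟨_, w, ((∑ l, t l • v l : icl k u) : K), Module.finrank_pos, hw0, ?_, hA1, hmonA _, ?_,
    hA2, hB⟩
  · rw [eq_top_iff]
    intro z _
    have hz : z ∈ Submodule.span k⟮w⟯ (Set.range fun i : Fin (Module.finrank k⟮w⟯ K) =>
      ((∑ l, t l • v l : icl k u) : K) ^ (i : ℕ)) := by
      rw [hspan _ hA1]; trivial
    have hle : k⟮w⟯ ≤ adjoin k {w, ((∑ l, t l • v l : icl k u) : K)} :=
      adjoin.mono _ _ _ (by simp)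
    induction hz using Submodule.span_induction with
    | mem x hx =>
      obtain ⟨i, rfl⟩ := hx
      exact pow_mem (subset_adjoin _ _ (by simp)) _
    | zero => exact zero_mem _
    | add x y _ _ hx hy => exact add_mem (hx trivial) (hy trivial)
    | smul a x _ hx =>
      exact mul_mem (hle a.2) (hx trivial)
  · rw [← hgg]
    exact hmonB _

end Model
end Polynomial.NodalCurve

namespace Polynomial.NodalCurve

set_option linter.unusedSectionVars false
section Curve
open Polynomial

variable {k : Type*} [Field k]

/-- Dehomogenisation `x₂ = 1`. -/
noncomputable def Phi : MvPolynomial (Fin 3) k →ₐ[k] k[X][X] :=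
  MvPolynomial.aeval ![X, C X, 1]

/-- Dehomogenisation `x₁ = 1`. -/
noncomputable def Phi' : MvPolynomial (Fin 3) k →ₐ[k] k[X][X] :=
  MvPolynomial.aeval ![X, 1, C X]

lemma Phi_C (a : k) : Phi (MvPolynomial.C a) = C (C a) := by
  rw [Phi, MvPolynomial.aeval_C]; rfl

lemma Phi'_C (a : k) : Phi' (MvPolynomial.C a) = C (C a) := by
  rw [Phi', MvPolynomial.aeval_C]; rfl

@[simp] lemma Phi_X0 : Phi (MvPolynomial.X (0 : Fin 3) : MvPolynomial (Fin 3) k) = X := by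
  simp [Phi]
@[simp] lemma Phi_X1 : Phi (MvPolynomial.X (1 : Fin 3) : MvPolynomial (Fin 3) k) = C X := by
  simp [Phi]
@[simp] lemma Phi_X2 : Phi (MvPolynomial.X (2 : Fin 3) : MvPolynomial (Fin 3) k) = 1 := by
  simp [Phi]
@[simp] lemma Phi'_X0 : Phi' (MvPolynomial.X (0 : Fin 3) : MvPolynomial (Fin 3) k) = X := by
  simp [Phi']
@[simp] lemma Phi'_X1 : Phi' (MvPolynomial.X (1 : Fin 3) : MvPolynomial (Fin 3) k) = 1 := by
  simp [Phi']
@[simp] lemma Phi'_X2 : Phi' (MvPolynomial.X (2 : Fin 3) : MvPolynomial (Fin 3) k) = C X := by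
  simp [Phi']

lemma derivative_Phi (P : MvPolynomial (Fin 3) k) :
    derivative (Phi P) = Phi (MvPolynomial.pderiv 0 P) := by
  induction P using MvPolynomial.induction_on with
  | C a => simp [Phi_C]
  | add p q hp hq => simp [hp, hq]
  | mul_X p i hp =>
    rw [map_mul, derivative_mul, hp, Derivation.leibniz, smul_eq_mul, smul_eq_mul, map_add,
      map_mul, map_mul]
    fin_cases i <;> simp [MvPolynomial.pderiv_X] <;> ring

lemma derivative_Phi' (P : MvPolynomial (Fin 3) k) :
    derivative (Phi' P) = Phi' (MvPolynomial.pderiv 0 P) := by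
  induction P using MvPolynomial.induction_on with
  | C a => simp [Phi'_C]
  | add p q hp hq => simp [hp, hq]
  | mul_X p i hp =>
    rw [map_mul, derivative_mul, hp, Derivation.leibniz, smul_eq_mul, smul_eq_mul, map_add,
      map_mul, map_mul]
    fin_cases i <;> simp [MvPolynomial.pderiv_X] <;> ring

lemma derivative_eval_Phi (b : k) (P : MvPolynomial (Fin 3) k) :
    derivative (eval (C b) (Phi P)) = eval (C b) (Phi (MvPolynomial.pderiv 1 P)) := by
  induction P using MvPolynomial.induction_on with
  | C a => simp [Phi_C]
  | add p q hp hq => simp [hp, hq]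
  | mul_X p i hp =>
    rw [map_mul, eval_mul, derivative_mul, hp, Derivation.leibniz, smul_eq_mul, smul_eq_mul,
      map_add, map_mul, map_mul, eval_add, eval_mul, eval_mul]
    fin_cases i <;> simp [MvPolynomial.pderiv_X] <;> ring

lemma derivative_eval_Phi' (b : k) (P : MvPolynomial (Fin 3) k) :
    derivative (eval (C b) (Phi' P)) = eval (C b) (Phi' (MvPolynomial.pderiv 2 P)) := by
  induction P using MvPolynomial.induction_on with
  | C a => simp [Phi'_C]
  | add p q hp hq => simp [hp, hq]
  | mul_X p i hp =>
    rw [map_mul, eval_mul, derivative_mul, hp, Derivation.leibniz, smul_eq_mul, smul_eq_mul,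
      map_add, map_mul, map_mul, eval_add, eval_mul, eval_mul]
    fin_cases i <;> simp [MvPolynomial.pderiv_X] <;> ring

lemma eval_eval_Phi (b c : k) (P : MvPolynomial (Fin 3) k) :
    eval c (eval (C b) (Phi P)) = MvPolynomial.eval ![b, c, 1] P := by
  induction P using MvPolynomial.induction_on with
  | C a => simp [Phi_C]
  | add p q hp hq => simp [hp, hq]
  | mul_X p i hp =>
    rw [map_mul, eval_mul, eval_mul, hp, map_mul]
    fin_cases i <;> simp

lemma eval_eval_Phi' (b c : k) (P : MvPolynomial (Fin 3) k) :
    eval c (eval (C b) (Phi' P)) = MvPolynomial.eval ![b, 1, c] P := by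
  induction P using MvPolynomial.induction_on with
  | C a => simp [Phi'_C]
  | add p q hp hq => simp [hp, hq]
  | mul_X p i hp =>
    rw [map_mul, eval_mul, eval_mul, hp, map_mul]
    fin_cases i <;> simp

lemma sing_Phi (H : MvPolynomial (Fin 3) k) (c b : k) : Sing (Phi H) c b ↔
    MvPolynomial.eval ![b, c, 1] H = 0 ∧
    MvPolynomial.eval ![b, c, 1] (MvPolynomial.pderiv 1 H) = 0 ∧
    MvPolynomial.eval ![b, c, 1] (MvPolynomial.pderiv 0 H) = 0 := by
  rw [Sing, derivative_eval_Phi, derivative_Phi, eval_eval_Phi, eval_eval_Phi, eval_eval_Phi]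

lemma sing_Phi' (H : MvPolynomial (Fin 3) k) (c b : k) : Sing (Phi' H) c b ↔
    MvPolynomial.eval ![b, 1, c] H = 0 ∧
    MvPolynomial.eval ![b, 1, c] (MvPolynomial.pderiv 2 H) = 0 ∧
    MvPolynomial.eval ![b, 1, c] (MvPolynomial.pderiv 0 H) = 0 := by
  rw [Sing, derivative_eval_Phi', derivative_Phi', eval_eval_Phi', eval_eval_Phi', eval_eval_Phi']

lemma degHess_Phi (H : MvPolynomial (Fin 3) k) (c b : k) : DegHess (Phi H) c b ↔
    (MvPolynomial.eval ![b, c, 1] (MvPolynomial.pderiv 1 (MvPolynomial.pderiv 0 H))) ^ 2 =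
    MvPolynomial.eval ![b, c, 1] (MvPolynomial.pderiv 1 (MvPolynomial.pderiv 1 H)) *
    MvPolynomial.eval ![b, c, 1] (MvPolynomial.pderiv 0 (MvPolynomial.pderiv 0 H)) := by
  rw [DegHess, derivative_eval_Phi, derivative_eval_Phi, derivative_Phi, derivative_eval_Phi,
    derivative_Phi, eval_eval_Phi, eval_eval_Phi, eval_eval_Phi]

section evs
variable {K : Type*} [Field K] [Algebra k K]

lemma ev_Phi (w g : K) (P : MvPolynomial (Fin 3) k) :
    ev w g (Phi P) = MvPolynomial.aeval ![g, w, 1] P := by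
  induction P using MvPolynomial.induction_on with
  | C a => simp [Phi_C, ev]
  | add p q hp hq => simp [hp, hq]
  | mul_X p i hp =>
    rw [map_mul, map_mul, map_mul, hp]
    fin_cases i <;> simp [ev]

lemma ev_Phi' (w g : K) (P : MvPolynomial (Fin 3) k) :
    ev w g (Phi' P) = MvPolynomial.aeval ![g, 1, w] P := by
  induction P using MvPolynomial.induction_on with
  | C a => simp [Phi'_C, ev]
  | add p q hp hq => simp [hp, hq]
  | mul_X p i hp =>
    rw [map_mul, map_mul, map_mul, hp]
    fin_cases i <;> simp [ev]

end evs

/-- binary form attached to a univariate polynomial -/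
noncomputable def bin (N : ℕ) (c : k[X]) : MvPolynomial (Fin 3) k :=
  ∑ m ∈ Finset.range (N + 1),
    MvPolynomial.C (c.coeff m) * MvPolynomial.X 1 ^ m * MvPolynomial.X 2 ^ (N - m)

/-- homogenisation of `h` in degree `n` -/
noncomputable def hom3 (n : ℕ) (h : k[X][X]) : MvPolynomial (Fin 3) k :=
  ∑ i ∈ Finset.range (n + 1), bin (n - i) (h.coeff i) * MvPolynomial.X 0 ^ i

lemma bin_homog (N : ℕ) (c : k[X]) : (bin N c).IsHomogeneous N := by
  apply MvPolynomial.IsHomogeneous.sum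
  intro m hm
  have hm' := Finset.mem_range.1 hm
  have := ((MvPolynomial.isHomogeneous_C (Fin 3) (c.coeff m)).mul
    (MvPolynomial.isHomogeneous_X_pow (R := k) (1 : Fin 3) m)).mul
    (MvPolynomial.isHomogeneous_X_pow (R := k) (2 : Fin 3) (N - m))
  convert this using 1
  lia

lemma hom3_homog (n : ℕ) (h : k[X][X]) : (hom3 n h).IsHomogeneous n := by
  apply MvPolynomial.IsHomogeneous.sum
  intro m hm
  have hm' := Finset.mem_range.1 hm
  have := (bin_homog (n - m) (h.coeff m)).mul
    (MvPolynomial.isHomogeneous_X_pow (R := k) (0 : Fin 3) m)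
  convert this using 1
  lia

lemma hom3_eq (n : ℕ) (h : k[X][X]) (hm : h.Monic) (hn : h.natDegree = n) :
    hom3 n h = MvPolynomial.X 0 ^ n +
      ∑ i ∈ Finset.range n, bin (n - i) (h.coeff i) * MvPolynomial.X 0 ^ i := by
  rw [hom3, Finset.sum_range_succ, add_comm]
  congr 1
  have : h.coeff n = 1 := hn ▸ hm.coeff_natDegree
  rw [this]
  simp [bin]

lemma Phi_bin (N : ℕ) (c : k[X]) (hc : c.natDegree ≤ N) : Phi (bin N c) = C c := by
  rw [bin, map_sum]
  conv_rhs => rw [c.as_sum_range' (N + 1) (by lia), map_sum]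
  refine Finset.sum_congr rfl fun m _ => ?_
  rw [map_mul, map_mul, map_pow, map_pow, Phi_C, Phi_X1, Phi_X2, one_pow, mul_one,
    ← C_mul_X_pow_eq_monomial, ← C_pow, ← C_mul]

lemma Phi'_bin (N : ℕ) (c : k[X]) : Phi' (bin N c) =
    C (∑ m ∈ Finset.range (N + 1), C (c.coeff m) * X ^ (N - m)) := by
  rw [bin, map_sum, map_sum]
  refine Finset.sum_congr rfl fun m _ => ?_
  rw [map_mul, map_mul, map_pow, map_pow, Phi'_C, Phi'_X1, Phi'_X2, one_pow, mul_one,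
    ← C_pow, ← C_mul]

lemma monic_form {R : Type*} [CommRing R] [Nontrivial R] (n : ℕ) (β : ℕ → R) :
    (X ^ n + ∑ i ∈ Finset.range n, C (β i) * X ^ i : R[X]).Monic ∧
    (X ^ n + ∑ i ∈ Finset.range n, C (β i) * X ^ i : R[X]).natDegree = n := by
  have hd : (∑ i ∈ Finset.range n, C (β i) * X ^ i : R[X]).degree < n := by
    refine (degree_sum_le _ _).trans_lt ?_
    rw [Finset.sup_lt_iff (WithBot.bot_lt_coe _)]
    intro i hi
    refine (degree_C_mul_X_pow_le _ _).trans_lt ?_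
    exact_mod_cast Finset.mem_range.1 hi
  refine ⟨monic_X_pow_add hd, ?_⟩
  rw [natDegree_eq_of_degree_eq_some]
  rw [degree_add_eq_left_of_degree_lt] <;> rw [degree_X_pow]
  exact hd

lemma Phi_hom3 (n : ℕ) (h : k[X][X]) (hn : h.natDegree = n)
    (hc : ∀ i, i ≤ n → (h.coeff i).natDegree ≤ n - i) : Phi (hom3 n h) = h := by
  rw [hom3, map_sum]
  conv_rhs => rw [h.as_sum_range_C_mul_X_pow, hn]
  refine Finset.sum_congr rfl fun i hi => ?_
  have := Finset.mem_range.1 hi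
  rw [map_mul, map_pow, Phi_X0, Phi_bin _ _ (hc i (by lia))]

lemma Phi'_hom3 (n : ℕ) (h : k[X][X]) (hm : h.Monic) (hn : h.natDegree = n) :
    (Phi' (hom3 n h)).Monic ∧ (Phi' (hom3 n h)).natDegree = n := by
  have : Phi' (hom3 n h) = X ^ n + ∑ i ∈ Finset.range n,
      C (∑ m ∈ Finset.range (n - i + 1), C ((h.coeff i).coeff m) * X ^ (n - i - m)) * X ^ i := by
    rw [hom3_eq n h hm hn, map_add, map_pow, Phi'_X0, map_sum]
    congr 1
    refine Finset.sum_congr rfl fun i _ => ?_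
    rw [map_mul, map_pow, Phi'_X0, Phi'_bin]
  rw [this]
  exact monic_form _ _

lemma eval_hom3_inf (n : ℕ) (h : k[X][X]) (hm : h.Monic) (hn : h.natDegree = n) (v : Fin 3 → k)
    (h1 : v 1 = 0) (h2 : v 2 = 0) : MvPolynomial.eval v (hom3 n h) = v 0 ^ n := by
  rw [hom3_eq n h hm hn, map_add, map_pow, MvPolynomial.eval_X, map_sum, Finset.sum_eq_zero,
    add_zero]
  intro i hi
  have := Finset.mem_range.1 hi
  rw [map_mul, bin, map_sum, Finset.sum_eq_zero, zero_mul]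
  intro m hm
  have := Finset.mem_range.1 hm
  rw [map_mul, map_mul, map_pow, map_pow, MvPolynomial.eval_X, MvPolynomial.eval_X, h1, h2]
  rcases Nat.eq_zero_or_pos m with rfl | h
  · rw [zero_pow (n := n - i - 0) (by lia), mul_zero]
  · rw [zero_pow h.ne', mul_zero, zero_mul]

lemma exists_div (n : ℕ) (h : k[X][X]) (hm : h.Monic) (hn : h.natDegree = n) (hn0 : 0 < n)
    (P : MvPolynomial (Fin 3) k) :
    ∃ Q R, P = hom3 n h * Q + R ∧ ∀ d ∈ R.support, d 0 < n := by
  set e := MvPolynomial.finSuccEquiv k 2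
  have hX : e (MvPolynomial.X 0) = X := MvPolynomial.finSuccEquiv_X_zero
  have hX1 : e (MvPolynomial.X 1) = C (MvPolynomial.X 0) :=
    MvPolynomial.finSuccEquiv_X_succ (j := 0)
  have hX2 : e (MvPolynomial.X 2) = C (MvPolynomial.X 1) :=
    MvPolynomial.finSuccEquiv_X_succ (j := 1)
  have hC : ∀ a : k, e (MvPolynomial.C a) = C (MvPolynomial.C a) := by
    intro a
    simp [e, MvPolynomial.finSuccEquiv_apply]
  have hform : e (hom3 n h) = X ^ n + ∑ i ∈ Finset.range n,
      C (∑ m ∈ Finset.range (n - i + 1), MvPolynomial.C ((h.coeff i).coeff m) *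
        MvPolynomial.X 0 ^ m * MvPolynomial.X 1 ^ (n - i - m)) * X ^ i := by
    rw [hom3_eq n h hm hn, map_add, map_pow, hX, map_sum]
    congr 1
    refine Finset.sum_congr rfl fun i _ => ?_
    rw [map_mul, map_pow, hX, bin, map_sum, map_sum]
    congr 1
    refine Finset.sum_congr rfl fun m _ => ?_
    simp only [map_mul, map_pow, hX1, hX2, hC]
  obtain ⟨hmon, hdeg⟩ := monic_form (R := MvPolynomial (Fin 2) k) n (fun i =>
    ∑ m ∈ Finset.range (n - i + 1), MvPolynomial.C ((h.coeff i).coeff m) *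
        MvPolynomial.X 0 ^ m * MvPolynomial.X 1 ^ (n - i - m))
  rw [← hform] at hmon hdeg
  refine ⟨e.symm (e P /ₘ e (hom3 n h)), e.symm (e P %ₘ e (hom3 n h)), ?_, ?_⟩
  · apply e.injective
    rw [map_add, map_mul, AlgEquiv.apply_symm_apply, AlgEquiv.apply_symm_apply]
    exact ((add_comm _ _).trans (modByMonic_add_div (e P) _)).symm
  · rw [← MvPolynomial.degreeOf_lt_iff hn0, ← MvPolynomial.natDegree_finSuccEquiv]
    change (e _).natDegree < n
    rw [AlgEquiv.apply_symm_apply]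
    have := natDegree_modByMonic_lt (e P) hmon (by intro h1; rw [h1] at hdeg; simp at hdeg; lia)
    lia

end Curve
end Polynomial.NodalCurve

namespace Polynomial.NodalCurve

set_option linter.unusedSectionVars false
section Model
open Polynomial

variable {k K : Type*} [Field k] [Field K] [Algebra k K]

lemma natDegree_coeff_le (n : ℕ) (w g : K) (hn0 : 0 < n) (hw : w ≠ 0)
    (hind : ∀ p : k[X][X], p.natDegree < n → ev w g p = 0 → p = 0)
    (h h' : k[X][X]) (hm : h.Monic) (hn : h.natDegree = n) (he : ev w g h = 0)
    (hm' : h'.Monic) (hn' : h'.natDegree = n) (he' : ev w⁻¹ (g * w⁻¹) h' = 0) :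
    ∀ i, i ≤ n → (h.coeff i).natDegree ≤ n - i := by
  set M := ∑ i ∈ Finset.range (n + 1), (h'.coeff i).natDegree with hM
  have hMi : ∀ i, i ≤ n → (h'.coeff i).natDegree ≤ M := fun i hi =>
    Finset.single_le_sum (f := fun i => (h'.coeff i).natDegree) (fun _ _ => Nat.zero_le _)
      (Finset.mem_range.2 (by lia))
  set q : k[X][X] := ∑ i ∈ Finset.range (n + 1), C (reflect (M + n - i) (h'.coeff i)) * X ^ i -
    C (X ^ M) * h with hq
  have hcoeff : ∀ i, q.coeff i = (if i ≤ n then reflect (M + n - i) (h'.coeff i) else 0) -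
      X ^ M * h.coeff i := by
    intro i
    rw [hq, coeff_sub, coeff_C_mul, finset_sum_coeff]
    congr 1
    simp only [coeff_C_mul_X_pow]
    rw [Finset.sum_ite_eq]
    simp [Nat.lt_succ_iff]
  have hq0 : q = 0 := by
    apply hind
    · by_contra! hcon
      have h7 := hcoeff q.natDegree
      have h8 : q.coeff q.natDegree = 0 := by
        rw [h7]
        rcases hcon.eq_or_lt with h9 | h9
        · have e1 : h'.coeff n = 1 := hn' ▸ hm'.coeff_natDegree
          have e2 : h.coeff n = 1 := hn ▸ hm.coeff_natDegree
          rw [← h9, if_pos le_rfl, e1, e2, Nat.add_sub_cancel, reflect_one, mul_one, sub_self]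
        · rw [if_neg (by lia), coeff_eq_zero_of_natDegree_lt (by lia), mul_zero, sub_zero]
      have h10 : q = 0 := leadingCoeff_eq_zero.1 h8
      rw [h10] at hcon
      simp at hcon
      lia
    · have h1 : ∀ i ∈ Finset.range (n + 1), ev w g (C (reflect (M + n - i) (h'.coeff i)) * X ^ i) =
          w ^ (M + n) * (aeval w⁻¹ (h'.coeff i) * (g * w⁻¹) ^ i) := by
        intro i hi
        have hi' := Finset.mem_range.1 hi
        letI := invertibleOfNonzero (inv_ne_zero hw)
        have := eval₂_reflect_mul_pow (algebraMap k K) w⁻¹ (M + n - i) (h'.coeff i)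
          ((hMi i (by lia)).trans (by lia))
        rw [invOf_eq_inv, inv_inv] at this
        have h2 : ev w g (C (reflect (M + n - i) (h'.coeff i)) * X ^ i) =
          eval₂ (algebraMap k K) w (reflect (M + n - i) (h'.coeff i)) * g ^ i := by
          simp [ev, aeval_def]
        rw [h2, aeval_def, ← this]
        have h3 : w ^ (M + n) = w ^ (M + n - i) * w ^ i := by
          rw [← pow_add]; congr 1; lia
        rw [h3, inv_pow, mul_pow, inv_pow]
        field_simp
      have h4 : ∑ i ∈ Finset.range (n + 1), (aeval w⁻¹ (h'.coeff i) * (g * w⁻¹) ^ i) = 0 := by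
        have := he'
        rw [ev, coe_eval₂RingHom, eval₂_eq_sum_range, hn'] at this
        exact this
      rw [hq, map_sub, map_mul, he, mul_zero, sub_zero, map_sum, Finset.sum_congr rfl h1,
        ← Finset.mul_sum, h4, mul_zero]
  intro i hi
  have h5 := hcoeff i
  rw [hq0, coeff_zero, if_pos hi, eq_comm, sub_eq_zero] at h5
  by_cases h0 : h.coeff i = 0
  · simp [h0]
  have h6 : (reflect (M + n - i) (h'.coeff i)).natDegree ≤ M + n - i := by
    refine (natDegree_reflect_le).trans (max_le le_rfl ((hMi i hi).trans (by lia)))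
  rw [h5, natDegree_mul (pow_ne_zero _ X_ne_zero) h0, natDegree_X_pow] at h6
  lia

end Model
end Polynomial.NodalCurve

namespace Polynomial.NodalCurve

set_option linter.unusedSectionVars false
section Gen
open Polynomial

variable {k K : Type*} [Field k] [Field K] [Algebra k K]

/-- `x` is a generic point of the projective curve `F = 0`. -/
def GenPt (F : MvPolynomial (Fin 3) k) (x : Fin 3 → K) : Prop :=
  ∀ (m : ℕ) (P : MvPolynomial (Fin 3) k), P.IsHomogeneous m →
    (MvPolynomial.aeval x P = 0 ↔ F ∣ P)

lemma aeval_scale {A : Type*} [CommRing A] [Algebra k A] (c : A) (x : Fin 3 → A) {m : ℕ}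
    {P : MvPolynomial (Fin 3) k} (hP : P.IsHomogeneous m) :
    MvPolynomial.aeval (fun i => c * x i) P = c ^ m * MvPolynomial.aeval x P := by
  rw [MvPolynomial.aeval_def, MvPolynomial.aeval_def, MvPolynomial.eval₂_eq',
    MvPolynomial.eval₂_eq', Finset.mul_sum]
  refine Finset.sum_congr rfl fun d hd => ?_
  have h1 : d.degree = m := by
    by_contra h
    exact (MvPolynomial.mem_support_iff.1 hd) (hP.coeff_eq_zero h)
  have h2 : ∏ i, (c * x i) ^ d i = c ^ m * ∏ i, x i ^ d i := by
    simp_rw [mul_pow]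
    rw [Finset.prod_mul_distrib, Finset.prod_pow_eq_pow_sum, ← h1, Finsupp.degree_eq_sum]
  rw [h2]; ring

lemma eval_scale (c : k) (x : Fin 3 → k) {m : ℕ}
    {P : MvPolynomial (Fin 3) k} (hP : P.IsHomogeneous m) :
    MvPolynomial.eval (fun i => c * x i) P = c ^ m * MvPolynomial.eval x P := by
  have := aeval_scale c x hP
  rwa [MvPolynomial.aeval_eq_eval, MvPolynomial.aeval_eq_eval] at this

lemma dvd_hc {H Q : MvPolynomial (Fin 3) k} {n : ℕ} (hH : H.IsHomogeneous n) (m : ℕ) :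
    H ∣ MvPolynomial.homogeneousComponent m (H * Q) := by
  rw [← MvPolynomial.sum_homogeneousComponent Q, Finset.mul_sum, map_sum]
  refine Finset.dvd_sum fun i _ => ?_
  rw [MvPolynomial.homogeneousComponent_of_mem
    (hH.mul (MvPolynomial.homogeneousComponent_isHomogeneous i Q))]
  split_ifs
  · exact dvd_mul_right _ _
  · exact dvd_zero _

lemma Phi_eq_sum (P : MvPolynomial (Fin 3) k) :
    Phi P = ∑ d ∈ P.support, C (C (P.coeff d) * X ^ d 1) * X ^ d 0 := by
  rw [Phi, MvPolynomial.aeval_def, MvPolynomial.eval₂_eq']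
  refine Finset.sum_congr rfl fun d hd => ?_
  rw [Fin.prod_univ_three]
  simp [algebraMap_apply]
  ring

lemma natDegree_Phi_lt {n : ℕ} (hn : 0 < n) (R : MvPolynomial (Fin 3) k)
    (hR : ∀ d ∈ R.support, d 0 < n) : (Phi R).natDegree < n := by
  have : (Phi R).natDegree ≤ n - 1 := by
    rw [Phi_eq_sum]
    refine natDegree_sum_le_of_forall_le _ _ fun d hd => ?_
    refine (natDegree_C_mul_X_pow_le _ _).trans ?_
    have := hR d hd
    lia
  lia

lemma Phi_inj {m : ℕ} (P : MvPolynomial (Fin 3) k) (hP : P.IsHomogeneous m) (h : Phi P = 0) :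
    P = 0 := by
  ext d
  rw [MvPolynomial.coeff_zero]
  by_contra hd
  have hdeg : ∀ e ∈ P.support, e 0 + e 1 + e 2 = m := by
    intro e he
    have : e.degree = m := by
      by_contra h
      exact (MvPolynomial.mem_support_iff.1 he) (hP.coeff_eq_zero h)
    rw [Finsupp.degree_eq_sum, Fin.sum_univ_three] at this
    exact this
  have hds := MvPolynomial.mem_support_iff.2 hd
  have h1 : ((Phi P).coeff (d 0)).coeff (d 1) = P.coeff d := by
    rw [Phi_eq_sum, finsetSum_coeff, finsetSum_coeff, Finset.sum_eq_single d]
    · rw [coeff_C_mul_X_pow, if_pos rfl, coeff_C_mul_X_pow, if_pos rfl]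
    · intro e he hne
      rw [coeff_C_mul_X_pow]
      split_ifs with h2
      · rw [coeff_C_mul_X_pow]
        rw [if_neg]
        intro h3
        apply hne
        have h4 := hdeg e he
        have h5 := hdeg d hds
        ext i
        fin_cases i <;> simp <;> lia
      · simp
    · intro h; exact absurd hds h
  rw [h, coeff_zero, coeff_zero] at h1
  exact hd h1.symm

lemma genPt_hom3 (n : ℕ) (w g : K) (hn0 : 0 < n)
    (hind : ∀ p : k[X][X], p.natDegree < n → ev w g p = 0 → p = 0)
    (h : k[X][X]) (hm : h.Monic) (hn : h.natDegree = n) (he : ev w g h = 0)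
    (hc : ∀ i, i ≤ n → (h.coeff i).natDegree ≤ n - i) : GenPt (hom3 n h) ![g, w, 1] := by
  have hH : MvPolynomial.aeval ![g, w, 1] (hom3 n h) = 0 := by
    rw [← ev_Phi, Phi_hom3 n h hn hc, he]
  intro m P hP
  constructor
  · intro h0
    obtain ⟨Q, R, hPQ, hR⟩ := exists_div n h hm hn hn0 P
    have h1 := congrArg (MvPolynomial.homogeneousComponent m) hPQ
    rw [map_add, MvPolynomial.homogeneousComponent_eq_self hP] at h1
    have hd := dvd_hc (Q := Q) (hom3_homog n h) m
    set R' := MvPolynomial.homogeneousComponent m R with hR'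
    have h2 : MvPolynomial.aeval ![g, w, 1] R' = 0 := by
      obtain ⟨Q', hQ'⟩ := hd
      rw [h1, hQ', map_add, map_mul, hH, zero_mul, zero_add] at h0
      exact h0
    have h3 : R' = 0 := by
      apply Phi_inj R' (MvPolynomial.homogeneousComponent_isHomogeneous m R)
      apply hind _ (natDegree_Phi_lt hn0 _ _)
      · rw [ev_Phi, h2]
      · intro d hd
        apply hR
        rw [MvPolynomial.mem_support_iff] at hd ⊢
        rw [hR', MvPolynomial.coeff_homogeneousComponent] at hd
        intro h
        rw [h] at hd
        simp at hd
    rw [h1, h3, add_zero]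
    exact hd
  · rintro ⟨Q, rfl⟩
    rw [map_mul, hH, zero_mul]

lemma GenPt.prime {F : MvPolynomial (Fin 3) k} {n : ℕ} (hF : F.IsHomogeneous n) (h0 : F ≠ 0)
    {y : Fin 3 → K} (hg : GenPt F y) : Prime F := by
  let θ : MvPolynomial (Fin 3) k →ₐ[k] K[X] := MvPolynomial.aeval (fun i => X * C (y i))
  have hθ : ∀ m P, MvPolynomial.IsHomogeneous P m →
      θ P = X ^ m * C (MvPolynomial.aeval y P) := by
    intro m P hP
    change MvPolynomial.aeval (fun i => X * C (y i)) P = _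
    rw [aeval_scale X (fun i => C (y i)) hP]
    congr 1
    exact (MvPolynomial.comp_aeval_apply y (CAlgHom (R := k) (A := K)) P).symm
  have hker : RingHom.ker θ = Ideal.span {F} := by
    ext P
    rw [RingHom.mem_ker, Ideal.mem_span_singleton]
    constructor
    · intro h
      rw [← MvPolynomial.sum_homogeneousComponent P, map_sum] at h
      rw [← MvPolynomial.sum_homogeneousComponent P]
      refine Finset.dvd_sum fun m hm => ?_
      rw [← hg m _ (MvPolynomial.homogeneousComponent_isHomogeneous m P)]
      have := congrArg (fun q => coeff q m) h
      simp only [coeff_zero, finsetSum_coeff] at this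
      rw [Finset.sum_eq_single m] at this
      · rw [hθ _ _ (MvPolynomial.homogeneousComponent_isHomogeneous m P), mul_comm,
          coeff_C_mul_X_pow, if_pos rfl] at this
        exact this
      · intro i _ hi
        rw [hθ _ _ (MvPolynomial.homogeneousComponent_isHomogeneous i P), mul_comm,
          coeff_C_mul_X_pow, if_neg hi.symm]
      · intro h; exact absurd hm h
    · rintro ⟨Q, rfl⟩
      rw [map_mul, hθ n F hF, (hg n F hF).2 dvd_rfl, map_zero, mul_zero, zero_mul]
  rw [← Ideal.span_singleton_prime h0, ← hker]
  exact RingHom.ker_isPrime θ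

end Gen
end Polynomial.NodalCurve

namespace Polynomial.NodalCurve

set_option linter.unusedSectionVars false
section Node
open Polynomial

variable {k : Type} [Field k]

lemma pderiv_comm' (i j : Fin 3) (H : MvPolynomial (Fin 3) k) :
    MvPolynomial.pderiv i (MvPolynomial.pderiv j H) =
    MvPolynomial.pderiv j (MvPolynomial.pderiv i H) := by
  induction H using MvPolynomial.induction_on with
  | C a => simp
  | add p q hp hq => simp [hp, hq]
  | mul_X p l hp =>
    simp only [Derivation.leibniz, smul_eq_mul, map_add, MvPolynomial.pderiv_X, hp,
      Pi.single_apply]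
    split_ifs <;> simp <;> ring

lemma dirDeriv_two (H : MvPolynomial (Fin 3) k) (v w : Fin 3 → k) :
    dirDeriv H v w 2 = ∑ a, ∑ b, MvPolynomial.eval v (MvPolynomial.pderiv a
      (MvPolynomial.pderiv b H)) * (w a * w b) := by
  rw [dirDeriv, ← (finTwoArrowEquiv (Fin 3)).symm.sum_comp, Fintype.sum_prod_type]
  refine Finset.sum_congr rfl fun a _ => Finset.sum_congr rfl fun b _ => ?_
  simp [pderivList, List.ofFn_succ]

lemma node_of_hess [CharZero k] (H : MvPolynomial (Fin 3) k) (v : Fin 3 → k) (hv : IsSingularAt H v)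
    (hh : (MvPolynomial.eval v (MvPolynomial.pderiv 1 (MvPolynomial.pderiv 0 H))) ^ 2 ≠
      MvPolynomial.eval v (MvPolynomial.pderiv 1 (MvPolynomial.pderiv 1 H)) *
      MvPolynomial.eval v (MvPolynomial.pderiv 0 (MvPolynomial.pderiv 0 H))) : IsNodeAt H v := by
  refine ⟨hv.1, hv.2.1, ⟨?_, ?_⟩, ?_⟩
  · intro s hs
    match s, hs with
    | [], _ => exact hv.2.1
    | [i], _ => exact hv.2.2 i
    | a :: b :: t, hs => simp at hs
  · by_contra! hcon
    apply hh
    have h1 := hcon [1, 0] rfl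
    have h2 := hcon [1, 1] rfl
    simp only [pderivList, List.foldr] at h1 h2
    rw [h1, h2]; simp
  · rintro ⟨c, l, hl⟩
    apply hh
    have h0 := hl ![1, 0, 0]
    have h1 := hl ![0, 1, 0]
    have h2 := hl ![1, 1, 0]
    simp only [dirDeriv_two, Fin.sum_univ_three, Matrix.cons_val_zero, Matrix.cons_val_one,
      Matrix.cons_val, mul_one, mul_zero, add_zero, zero_add] at h0 h1 h2
    rw [pderiv_comm' 0 1 H] at h2
    rw [h0, h1] at h2
    have h3 : MvPolynomial.eval v (MvPolynomial.pderiv 1 (MvPolynomial.pderiv 0 H)) =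
        c * l 0 * l 1 := by
      have : (2 : k) ≠ 0 := two_ne_zero
      apply mul_left_cancel₀ this
      linear_combination h2
    rw [h0, h1, h3]; ring

lemma node_check [CharZero k] (n : ℕ) (H : MvPolynomial (Fin 3) k) (hH : H.IsHomogeneous n)
    (hA : ∀ c b, Sing (Phi H) c b → ¬ DegHess (Phi H) c b) (hB : ∀ b, ¬ Sing (Phi' H) 0 b)
    (hC : ∀ v : Fin 3 → k, v 1 = 0 → v 2 = 0 → v ≠ 0 → MvPolynomial.eval v H ≠ 0) :
    ∀ v, IsSingularAt H v → IsNodeAt H v := by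
  intro v hv
  by_cases h2 : v 2 = 0
  · exfalso
    by_cases h1 : v 1 = 0
    · exact hC v h1 h2 hv.1 hv.2.1
    · have e : (![(v 1)⁻¹ * v 0, 1, 0] : Fin 3 → k) = fun i => (v 1)⁻¹ * v i := by
        ext i; fin_cases i <;> simp [h1, h2]
      apply hB ((v 1)⁻¹ * v 0)
      rw [sing_Phi', e, eval_scale _ _ hH, eval_scale _ _ hH.pderiv, eval_scale _ _ hH.pderiv,
        hv.2.1, hv.2.2, hv.2.2]
      simp
  · have e : (![(v 2)⁻¹ * v 0, (v 2)⁻¹ * v 1, 1] : Fin 3 → k) = fun i => (v 2)⁻¹ * v i := by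
      ext i; fin_cases i <;> simp [h2]
    have hs := hA ((v 2)⁻¹ * v 1) ((v 2)⁻¹ * v 0) (by
      rw [sing_Phi, e, eval_scale _ _ hH, eval_scale _ _ hH.pderiv, eval_scale _ _ hH.pderiv,
        hv.2.1, hv.2.2, hv.2.2]
      simp)
    rw [degHess_Phi, e, eval_scale _ _ hH.pderiv.pderiv, eval_scale _ _ hH.pderiv.pderiv,
      eval_scale _ _ hH.pderiv.pderiv] at hs
    apply node_of_hess H v hv
    intro h3
    apply hs
    rw [mul_pow, h3]; ring

end Node
end Polynomial.NodalCurve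

namespace Polynomial.NodalCurve

set_option linter.unusedSectionVars false
section Nodal
open Polynomial
open scoped IntermediateField

variable {k K : Type} [Field k] [Field K] [Algebra k K]

theorem exists_nodal [IsAlgClosed k] [CharZero k] (u : K) (htr : Transcendental k u)
    [FiniteDimensional k⟮u⟯ K] : ∃ (D : PlaneCurve k) (y : Fin 3 → K), y 2 = 1 ∧ GenPt D.F y ∧
      IntermediateField.adjoin k (Set.range y) = ⊤ ∧
      ∀ v : Fin 3 → k, IsSingularAt D.F v → IsNodeAt D.F v := by
  obtain ⟨n, w, g, hn0, hw, htop, hind, ⟨h, hm, hn, he⟩, ⟨h', hm', hn', he'⟩, hA, hB⟩ :=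
    exists_model u htr
  have hc := natDegree_coeff_le n w g hn0 hw hind h h' hm hn he hm' hn' he'
  have hgen := genPt_hom3 n w g hn0 hind h hm hn he hc
  have hhom := hom3_homog n h
  have hPhi := Phi_hom3 n h hn hc
  have h0 : hom3 n h ≠ 0 := by
    intro h0
    rw [h0, map_zero] at hPhi
    exact hm.ne_zero hPhi.symm
  have hpr := hgen.prime hhom h0
  refine ⟨⟨n, hom3 n h, hhom, hpr.irreducible⟩, ![g, w, 1], rfl, hgen, ?_, ?_⟩
  · rw [eq_top_iff, ← htop, IntermediateField.adjoin_le_iff]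
    rintro z (rfl | rfl)
    · exact IntermediateField.subset_adjoin _ _ ⟨1, rfl⟩
    · exact IntermediateField.subset_adjoin _ _ ⟨0, rfl⟩
  · refine node_check n _ hhom ?_ ?_ ?_
    · rw [hPhi]
      exact hA h hm hn he
    · obtain ⟨hm1, hn1⟩ := Phi'_hom3 n h hm hn
      refine hB _ hm1 hn1 ?_
      have e : (![g * w⁻¹, 1, w⁻¹] : Fin 3 → K) = fun i => w⁻¹ * (![g, w, 1] : Fin 3 → K) i := by
        ext i; fin_cases i <;> simp [hw, mul_comm]
      rw [ev_Phi', e, aeval_scale _ _ hhom, (hgen n _ hhom).2 dvd_rfl, mul_zero]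
    · intro v h1 h2 hv
      rw [eval_hom3_inf n h hm hn v h1 h2]
      refine pow_ne_zero _ fun h3 => hv ?_
      ext i; fin_cases i <;> simp [h1, h2, h3]

end Nodal

section Bir
open Polynomial

variable {k K : Type} [Field k] [Field K] [Algebra k K]

lemma exists_forms (x y : Fin 3 → K) (j : Fin 3) (hj : x j = 1)
    (hx : IntermediateField.adjoin k (Set.range x) = ⊤) :
    ∃ (d : ℕ) (φ : Fin 3 → MvPolynomial (Fin 3) k) (l : K), l ≠ 0 ∧
      (∀ i, (φ i).IsHomogeneous d) ∧ ∀ i, MvPolynomial.aeval x (φ i) = l * y i := by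
  have h1 : ∀ i, ∃ p q : MvPolynomial (Fin 3) k, MvPolynomial.aeval x q ≠ 0 ∧
      MvPolynomial.aeval x p = MvPolynomial.aeval x q * y i := by
    intro i
    have : y i ∈ IntermediateField.adjoin k (Set.range x) := hx ▸ IntermediateField.mem_top
    rw [IntermediateField.mem_adjoin_range_iff] at this
    obtain ⟨r, s, hrs⟩ := this
    by_cases hs : MvPolynomial.aeval x s = 0
    · exact ⟨0, 1, by simp, by simp [hrs, hs]⟩
    · exact ⟨r, s, hs, by rw [hrs]; field_simp⟩
  choose p q hq hp using h1
  let P : Fin 3 → MvPolynomial (Fin 3) k := fun i => p i * ∏ t ∈ Finset.univ.erase i, q t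
  let N := ∑ i, (P i).totalDegree
  refine ⟨N, fun i => ∑ m ∈ Finset.range ((P i).totalDegree + 1), MvPolynomial.X j ^ (N - m) *
    MvPolynomial.homogeneousComponent m (P i), ∏ i, MvPolynomial.aeval x (q i),
    Finset.prod_ne_zero_iff.2 fun i _ => hq i, ?_, ?_⟩
  · intro i
    apply MvPolynomial.IsHomogeneous.sum
    intro m hm
    have hm' := Finset.mem_range.1 hm
    have hle : (P i).totalDegree ≤ N := Finset.single_le_sum (f := fun i => (P i).totalDegree)
      (fun _ _ => Nat.zero_le _) (Finset.mem_univ i)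
    have := (MvPolynomial.isHomogeneous_X_pow (R := k) j (N - m)).mul
      (MvPolynomial.homogeneousComponent_isHomogeneous m (P i))
    convert this using 1
    lia
  · intro i
    have h2 : MvPolynomial.aeval x (P i) = (∏ i, MvPolynomial.aeval x (q i)) * y i := by
      rw [map_mul, hp, map_prod, ← Finset.mul_prod_erase _ _ (Finset.mem_univ i)]
      ring
    rw [← h2]
    conv_rhs => rw [← MvPolynomial.sum_homogeneousComponent (P i)]
    rw [map_sum, map_sum]
    refine Finset.sum_congr rfl fun m _ => ?_
    rw [map_mul, map_pow, MvPolynomial.aeval_X, hj, one_pow, one_mul]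

lemma aeval_bind (x y : Fin 3 → K) (φ : Fin 3 → MvPolynomial (Fin 3) k) (l : K)
    (hφ : ∀ i, MvPolynomial.aeval x (φ i) = l * y i) {m : ℕ} {P : MvPolynomial (Fin 3) k}
    (hP : P.IsHomogeneous m) : MvPolynomial.aeval x (MvPolynomial.bind₁ φ P) =
      l ^ m * MvPolynomial.aeval y P := by
  rw [MvPolynomial.aeval_bind₁]
  simp_rw [hφ]
  exact aeval_scale l y hP

lemma bir_map (F G : MvPolynomial (Fin 3) k) (x y : Fin 3 → K) (hF : GenPt F x) (hG : GenPt G y)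
    {n d : ℕ} (hGn : G.IsHomogeneous n) (φ : Fin 3 → MvPolynomial (Fin 3) k) (l : K)
    (hd : ∀ i, (φ i).IsHomogeneous d)
    (hφ : ∀ i, MvPolynomial.aeval x (φ i) = l * y i) :
    MvPolynomial.bind₁ φ G ∈ Ideal.span {F} := by
  have h1 : (MvPolynomial.bind₁ φ G).IsHomogeneous (d * n) := hGn.aeval φ hd
  rw [Ideal.mem_span_singleton, ← hF _ _ h1, aeval_bind x y φ l hφ hGn, (hG _ _ hGn).2 dvd_rfl, mul_zero]

lemma bir_inv (F : MvPolynomial (Fin 3) k) (x y : Fin 3 → K) (hF : GenPt F x)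
    (j : Fin 3) (hj : x j = 1) {d e : ℕ} (φ ψ : Fin 3 → MvPolynomial (Fin 3) k) (l m : K)
    (hl : l ≠ 0) (hm : m ≠ 0)
    (hd : ∀ i, (φ i).IsHomogeneous d) (he : ∀ i, (ψ i).IsHomogeneous (1 + e))
    (hφ : ∀ i, MvPolynomial.aeval x (φ i) = l * y i)
    (hψ : ∀ i, MvPolynomial.aeval y (ψ i) = m * x i) :
    ∃ lam : MvPolynomial (Fin 3) k, lam ∉ Ideal.span {F} ∧
      ∀ i, MvPolynomial.bind₁ (fun i => MvPolynomial.X j * φ i) (ψ i) - lam * MvPolynomial.X i ∈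
        Ideal.span {F} := by
  have hlam : (MvPolynomial.X j ^ e * MvPolynomial.bind₁ φ (ψ j)).IsHomogeneous
      (e + d * (1 + e)) :=
    (MvPolynomial.isHomogeneous_X_pow (R := k) j e).mul ((he j).aeval φ hd)
  have hval : MvPolynomial.aeval x (MvPolynomial.X j ^ e * MvPolynomial.bind₁ φ (ψ j)) =
      l ^ (1 + e) * m := by
    rw [map_mul, map_pow, MvPolynomial.aeval_X, aeval_bind x y φ l hφ (he j), hψ, hj]
    ring
  refine ⟨MvPolynomial.X j ^ e * MvPolynomial.bind₁ φ (ψ j), ?_, fun i => ?_⟩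
  · rw [Ideal.mem_span_singleton, ← hF _ _ hlam, hval]
    exact mul_ne_zero (pow_ne_zero _ hl) hm
  · have h1 : (MvPolynomial.bind₁ (fun i => MvPolynomial.X j * φ i) (ψ i)).IsHomogeneous
        ((1 + d) * (1 + e)) :=
      (he i).aeval _ fun i => (MvPolynomial.isHomogeneous_X k j).mul (hd i)
    have h2 := hlam.mul (MvPolynomial.isHomogeneous_X k i)
    have h3 : e + d * (1 + e) + 1 = (1 + d) * (1 + e) := by ring
    rw [h3] at h2
    rw [Ideal.mem_span_singleton, ← hF _ _ (h1.sub h2), map_sub, map_mul, hval,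
      MvPolynomial.aeval_X, aeval_bind x y _ l (by
        intro i; rw [map_mul, MvPolynomial.aeval_X, hj, one_mul, hφ]) (he i), hψ]
    ring

theorem birEquiv_of_genPt (F G : MvPolynomial (Fin 3) k) {n n' : ℕ} (hFn : F.IsHomogeneous n)
    (hGn : G.IsHomogeneous n') (x y : Fin 3 → K) (hF : GenPt F x) (hG : GenPt G y)
    (j j' : Fin 3) (hj : x j = 1) (hj' : y j' = 1)
    (hx : IntermediateField.adjoin k (Set.range x) = ⊤)
    (hy : IntermediateField.adjoin k (Set.range y) = ⊤) : BirEquiv F G := by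
  obtain ⟨d, φ, l, hl, hd, hφ⟩ := exists_forms x y j hj hx
  obtain ⟨e, ψ, m, hm, he, hψ⟩ := exists_forms y x j' hj' hy
  have hd' : ∀ i, (MvPolynomial.X j * φ i).IsHomogeneous (1 + d) := fun i =>
    (MvPolynomial.isHomogeneous_X k j).mul (hd i)
  have he' : ∀ i, (MvPolynomial.X j' * ψ i).IsHomogeneous (1 + e) := fun i =>
    (MvPolynomial.isHomogeneous_X k j').mul (he i)
  have hφ' : ∀ i, MvPolynomial.aeval x (MvPolynomial.X j * φ i) = l * y i := by
    intro i; rw [map_mul, MvPolynomial.aeval_X, hj, one_mul, hφ]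
  have hψ' : ∀ i, MvPolynomial.aeval y (MvPolynomial.X j' * ψ i) = m * x i := by
    intro i; rw [map_mul, MvPolynomial.aeval_X, hj', one_mul, hψ]
  exact ⟨fun i => MvPolynomial.X j * φ i, fun i => MvPolynomial.X j' * ψ i, ⟨_, hd'⟩, ⟨_, he'⟩,
    bir_map F G x y hF hG hGn _ l hd' hφ', bir_map G F y x hG hF hFn _ m he' hψ',
    bir_inv F x y hF j hj φ _ l m hl hm hd he' hφ hψ',
    bir_inv G y x hG j' hj' ψ _ m l hm hl he hd' hψ hφ'⟩

end Bir
end Polynomial.NodalCurve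

namespace Polynomial.NodalCurve

set_option linter.unusedSectionVars false
section Pt
open Polynomial
open scoped IntermediateField

variable {k : Type} [Field k]

lemma dvd_linear (F L : MvPolynomial (Fin 3) k) (hF : Irreducible F) (h0 : L ≠ 0)
    (hL : L.IsHomogeneous 1) (h : F ∣ L) : ∃ q : k, L = F * MvPolynomial.C q := by
  obtain ⟨Q, rfl⟩ := h
  have hF0 := left_ne_zero_of_mul h0
  have hQ0 := right_ne_zero_of_mul h0
  have h1 := hL.totalDegree h0
  rw [MvPolynomial.totalDegree_mul_of_isDomain hF0 hQ0] at h1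
  have h2 : F.totalDegree ≠ 0 := by
    intro h
    rw [MvPolynomial.totalDegree_eq_zero_iff_eq_C] at h
    apply hF.not_isUnit
    rw [h] at hF0 ⊢
    exact (isUnit_iff_ne_zero.2 fun h => hF0 (by rw [h, map_zero])).map MvPolynomial.C
  have h3 : Q.totalDegree = 0 := by lia
  rw [MvPolynomial.totalDegree_eq_zero_iff_eq_C] at h3
  exact ⟨_, by rw [← h3]⟩

lemma not_two_linear (F L M : MvPolynomial (Fin 3) k) (hF : Irreducible F)
    (hL : L.IsHomogeneous 1) (hM : M.IsHomogeneous 1) (p q : Fin 3 → k)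
    (h1 : MvPolynomial.eval p L ≠ 0) (h2 : MvPolynomial.eval p M = 0)
    (h3 : MvPolynomial.eval q M ≠ 0) (hFL : F ∣ L) (hFM : F ∣ M) : False := by
  have hL0 : L ≠ 0 := fun h => h1 (by rw [h, map_zero])
  have hM0 : M ≠ 0 := fun h => h3 (by rw [h, map_zero])
  obtain ⟨a, rfl⟩ := dvd_linear F L hF hL0 hL hFL
  obtain ⟨b, rfl⟩ := dvd_linear F M hF hM0 hM hFM
  simp at h1 h2 h3
  tauto

lemma exists_perm (j a : Fin 3) (h : a ≠ j) : ∃ e : Equiv.Perm (Fin 3), e 2 = j ∧ e 1 = a := by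
  revert j a; decide

variable {K : Type} [Field K] [Algebra k K]

lemma finDim_of_genPt (F : MvPolynomial (Fin 3) k) {n : ℕ} (hFn : F.IsHomogeneous n)
    (hF0 : F ≠ 0) (x : Fin 3 → K) (hF : GenPt F x) (j a : Fin 3) (hja : a ≠ j) (hj : x j = 1)
    (hx : IntermediateField.adjoin k (Set.range x) = ⊤) (htr : Transcendental k (x a)) :
    FiniteDimensional k⟮x a⟯ K := by
  obtain ⟨e, he2, he1⟩ := exists_perm j a hja
  set F' := MvPolynomial.rename e.symm F with hF'
  have hF'n : F'.IsHomogeneous n := hFn.rename_isHomogeneous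
  have hF'0 : F' ≠ 0 := fun h => hF0
    (MvPolynomial.rename_injective _ e.symm.injective (by rw [map_zero]; exact h))
  have hxe : (![x (e 0), x a, 1] : Fin 3 → K) = x ∘ e := by
    ext i; fin_cases i <;> simp [he1, he2, hj]
  have h1 : ev (x a) (x (e 0)) (Phi F') = 0 := by
    rw [ev_Phi, hxe, hF', MvPolynomial.aeval_rename, Function.comp_assoc, Equiv.self_comp_symm,
      Function.comp_id]
    exact (hF n F hFn).2 dvd_rfl
  have h2 : Phi F' ≠ 0 := fun h => hF'0 (Phi_inj F' hF'n h)
  let u' : k⟮x a⟯ := IntermediateField.AdjoinSimple.gen k (x a)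
  have hu' : algebraMap k⟮x a⟯ K u' = x a := rfl
  let f : k[X] →+* k⟮x a⟯ := (aeval u' : k[X] →ₐ[k] k⟮x a⟯).toRingHom
  have hfK : ∀ p, algebraMap k⟮x a⟯ K (f p) = aeval (x a) p := by
    intro p
    change algebraMap k⟮x a⟯ K (aeval u' p) = _
    rw [← aeval_algebraMap_apply, hu']
  have hf : Function.Injective f := by
    rw [injective_iff_map_eq_zero]
    intro p hp
    have := hfK p
    rw [hp, map_zero, eq_comm] at this
    exact (transcendental_iff.1 htr) p this
  have halg : IsAlgebraic k⟮x a⟯ (x (e 0)) := by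
    refine ⟨(Phi F').map f, (Polynomial.map_ne_zero_iff hf).2 h2, ?_⟩
    rw [aeval_def, eval₂_map]
    convert h1
    rw [ev, coe_eval₂RingHom]
    congr 1
    exact RingHom.ext hfK
  have hfin : FiniteDimensional k⟮x a⟯ k⟮x a⟯⟮x (e 0)⟯ :=
    IntermediateField.adjoin.finiteDimensional halg.isIntegral
  have htop : k⟮x a⟯⟮x (e 0)⟯ = ⊤ := by
    rw [eq_top_iff]
    intro z _
    have hle : IntermediateField.adjoin k (Set.range x) ≤
        (k⟮x a⟯⟮x (e 0)⟯).restrictScalars k := by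
      rw [IntermediateField.adjoin_le_iff]
      rintro _ ⟨i, rfl⟩
      obtain ⟨i, rfl⟩ := e.surjective i
      change x (e i) ∈ k⟮x a⟯⟮x (e 0)⟯
      fin_cases i
      · exact IntermediateField.mem_adjoin_simple_self _ _
      · change x (e 1) ∈ _
        rw [he1, ← hu']
        exact IntermediateField.algebraMap_mem _ _
      · change x (e 2) ∈ _
        rw [he2, hj]
        exact one_mem _
    rw [hx] at hle
    exact hle IntermediateField.mem_top
  rw [htop] at hfin
  exact (IntermediateField.topEquiv (F := k⟮x a⟯) (E := K)).toLinearEquiv.finiteDimensional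

theorem exists_genPt (F : MvPolynomial (Fin 3) k) (hF : Irreducible F) :
    ∃ (K : Type) (_ : Field K) (_ : Algebra k K) (x : Fin 3 → K) (j : Fin 3), x j = 1 ∧
      GenPt F x ∧ IntermediateField.adjoin k (Set.range x) = ⊤ := by
  have hpr : (Ideal.span {F}).IsPrime := (Ideal.span_singleton_prime hF.ne_zero).2 hF.prime
  let A := MvPolynomial (Fin 3) k ⧸ Ideal.span {F}
  let E := FractionRing A
  let π : MvPolynomial (Fin 3) k →ₐ[k] E :=
    (IsScalarTower.toAlgHom k A E).comp (Ideal.Quotient.mkₐ k (Ideal.span {F}))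
  have hπ : ∀ P, π P = 0 ↔ F ∣ P := by
    intro P
    rw [← Ideal.mem_span_singleton, ← Ideal.Quotient.eq_zero_iff_mem]
    change algebraMap A E (Ideal.Quotient.mk _ P) = 0 ↔ _
    exact FaithfulSMul.algebraMap_eq_zero_iff A E
  obtain ⟨j, hj⟩ : ∃ j, π (MvPolynomial.X j) ≠ 0 := by
    by_contra! h
    exact not_two_linear F (MvPolynomial.X 0) (MvPolynomial.X 1) hF (MvPolynomial.isHomogeneous_X _ _)
      (MvPolynomial.isHomogeneous_X _ _) ![1, 0, 0] ![0, 1, 0] (by simp) (by simp) (by simp)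
      ((hπ _).1 (h 0)) ((hπ _).1 (h 1))
  let t : Fin 3 → E := fun i => (π (MvPolynomial.X j))⁻¹ * π (MvPolynomial.X i)
  have ht : ∀ m P, MvPolynomial.IsHomogeneous P m → (MvPolynomial.aeval t P = 0 ↔ F ∣ P) := by
    intro m P hP
    rw [aeval_scale _ _ hP, ← hπ P]
    have : MvPolynomial.aeval (fun i => π (MvPolynomial.X i)) P = π P := by
      conv_rhs => rw [MvPolynomial.aeval_unique π]
      rfl
    rw [this, mul_eq_zero, or_iff_right (pow_ne_zero _ (inv_ne_zero hj))]
  let L := IntermediateField.adjoin k (Set.range t)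
  let x : Fin 3 → L := fun i => ⟨t i, IntermediateField.subset_adjoin _ _ ⟨i, rfl⟩⟩
  have hxt : ∀ P : MvPolynomial (Fin 3) k, ((MvPolynomial.aeval x P : L) : E) = MvPolynomial.aeval t P := by
    intro P
    exact MvPolynomial.comp_aeval_apply x L.val P
  refine ⟨L, inferInstance, inferInstance, x, j, ?_, ?_, ?_⟩
  · apply Subtype.ext
    exact inv_mul_cancel₀ hj
  · intro m P hP
    rw [← ht m P hP, ← hxt]
    exact (ZeroMemClass.coe_eq_zero (S' := L)).symm
  · rw [eq_top_iff]
    rintro ⟨z, hz⟩ _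
    have hz' := hz
    change z ∈ IntermediateField.adjoin k (Set.range t) at hz'
    rw [IntermediateField.mem_adjoin_range_iff] at hz' ⊢
    obtain ⟨r, s, hrs⟩ := hz'
    refine ⟨r, s, Subtype.ext ?_⟩
    change z = ((MvPolynomial.aeval x r : L) : E) / ((MvPolynomial.aeval x s : L) : E)
    rw [hxt, hxt, hrs]

lemma exists_trans [IsAlgClosed k] (F : MvPolynomial (Fin 3) k) (hF : Irreducible F)
    (x : Fin 3 → K) (hg : GenPt F x) (j : Fin 3) (hj : x j = 1) :
    ∃ a, a ≠ j ∧ Transcendental k (x a) := by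
  by_contra! hcon
  have h1 : ∀ a, a ≠ j → ∃ c : k, F ∣ MvPolynomial.X a - MvPolynomial.C c * MvPolynomial.X j := by
    intro a ha
    have h2 := hcon a ha
    rw [Transcendental, not_not] at h2
    obtain ⟨c, hc⟩ := minpoly.mem_range_of_degree_eq_one k (x a)
      (IsAlgClosed.degree_eq_one_of_irreducible k (minpoly.irreducible h2.isIntegral))
    refine ⟨c, ?_⟩
    rw [← hg 1 _ ((MvPolynomial.isHomogeneous_X _ _).sub (MvPolynomial.isHomogeneous_C_mul_X _ _))]
    simp [hj, hc]
  obtain ⟨a, b, ha, hb, hab⟩ : ∃ a b : Fin 3, a ≠ j ∧ b ≠ j ∧ a ≠ b := by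
    clear h1 hcon hj
    revert j; decide
  obtain ⟨c, hc⟩ := h1 a ha
  obtain ⟨d, hd⟩ := h1 b hb
  refine not_two_linear F _ _ hF
    ((MvPolynomial.isHomogeneous_X _ _).sub (MvPolynomial.isHomogeneous_C_mul_X _ _))
    ((MvPolynomial.isHomogeneous_X _ _).sub (MvPolynomial.isHomogeneous_C_mul_X _ _))
    (Pi.single a 1) (Pi.single b 1) ?_ ?_ ?_ hc hd
  · simp [Pi.single_apply, ha.symm]
  · simp [Pi.single_apply, ha.symm, hab.symm]
  · simp [Pi.single_apply, hb.symm]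

end Pt
end Polynomial.NodalCurve

/-- Every irreducible plane algebraic curve over an algebraically closed
field of characteristic zero is birationally equivalent to a plane curve whose only
singular points are nodes (ordinary double points). -/
theorem plane_curve_birational_to_nodal_curve
    (k : Type) [Field k] [IsAlgClosed k] [CharZero k] (C : PlaneCurve k) :
    ∃ D : PlaneCurve k, BirEquiv C.F D.F ∧
      ∀ v : Fin 3 → k, IsSingularAt D.F v → IsNodeAt D.F v := by
  obtain ⟨K, _, _, x, j, hj, hg, hx⟩ := Polynomial.NodalCurve.exists_genPt C.F C.irred
  obtain ⟨a, haj, htr⟩ := Polynomial.NodalCurve.exists_trans C.F C.irred x hg j hj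
  have := Polynomial.NodalCurve.finDim_of_genPt C.F C.homog C.irred.ne_zero x hg j a haj hj hx htr
  obtain ⟨D, y, hy2, hgy, hytop, hnode⟩ := Polynomial.NodalCurve.exists_nodal (x a) htr
  exact ⟨D, Polynomial.NodalCurve.birEquiv_of_genPt C.F D.F C.homog D.homog x y hg hgy j 2 hj hy2 hx hytop, hnode⟩
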